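/- arXiv:1707.02875 — 4 statements merged into one kernel-verified Lean document; each statement's English description precedes it below -/
import Mathlib

section
/- Let B_1, ..., B_n be topological balls (sets homeomorphic to the closed d-dimensional ball) in ℝ^d such that for any i ≠ j the intersection B_i ∩ B_j contains at most one point, and suppose X = ⋃_{i=1}^n B_i is simply connected. Then any simple closed curve contained in X lies entirely in some B_i. -/
open Set

/-- In a simply connected space covered by two closed sets with finite intersection, distinct
points cannot be joined by paths inside both of the sets. -/
theorem eq_of_joinedIn_of_joinedIn_of_finite_inter {Z : Type*} [TopologicalSpace Z] [T1Space Z]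
    [NormalSpace Z] [SimplyConnectedSpace Z] {K Y : Set Z} (hK : IsClosed K) (hY : IsClosed Y)
    (hKY : K ∪ Y = univ) (hfin : (K ∩ Y).Finite) {a b : Z} (habK : JoinedIn K a b)
    (habY : JoinedIn Y a b) : a = b := by
  classical
  by_contra hab
  obtain ⟨φ, hφ0, hφ1, -⟩ := exists_continuous_zero_one_of_isClosed
    (isClosed_singleton (x := a)) (hfin.sdiff (t := {a})).isClosed disjoint_sdiff_right
  have hφa : φ a = 0 := hφ0 rfl
  have hφb : φ b = 1 := hφ1 ⟨⟨habK.target_mem, habY.target_mem⟩, fun h => hab h.symm⟩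
  set f : Z → Circle := fun z => if z ∈ K then Circle.exp (2 * Real.pi * φ z) else 1
  have hfK : ∀ z ∈ K, f z = Circle.exp (2 * Real.pi * φ z) := fun _ hz => if_pos hz
  have hfY : ∀ z ∈ Y, f z = 1 := by
    intro z hz
    by_cases hzK : z ∈ K
    · rw [hfK z hzK]
      by_cases hza : z = a
      · simp [hza, hφa]
      · simp [show φ z = 1 from hφ1 ⟨⟨hzK, hz⟩, hza⟩]
    · exact if_neg hzK
  have hfc : Continuous f := by
    rw [← continuousOn_univ, ← hKY]
    refine ContinuousOn.union_of_isClosed ?_ ?_ hK hY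
    · exact ContinuousOn.congr (by fun_prop) hfK
    · exact continuousOn_const.congr hfY
  obtain ⟨γ, hγ⟩ := habK
  obtain ⟨δ, hδ⟩ := habY
  have hhom := (SimplyConnectedSpace.paths_homotopic γ δ).map ⟨f, hfc⟩
  let Γ : C(unitInterval, ℝ) := ⟨fun t => 2 * Real.pi * φ (γ t), by fun_prop⟩
  let Δ : C(unitInterval, ℝ) := ⟨fun _ => 0, by fun_prop⟩
  have hlift : Γ.HomotopicRel Δ {0, 1} := by
    refine (Circle.isCoveringMap_exp.homotopicRel_iff_comp ⟨0, by simp, ?_⟩).2 ?_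
    · simp [Γ, Δ, hφa]
    · have hΓ : ContinuousMap.comp ⟨Circle.exp, Circle.isCoveringMap_exp.continuous⟩ Γ =
          (γ.map hfc).toContinuousMap := by
        ext t
        simp [Γ, hfK _ (hγ t)]
      have hΔ : ContinuousMap.comp ⟨Circle.exp, Circle.isCoveringMap_exp.continuous⟩ Δ =
          (δ.map hfc).toContinuousMap := by
        ext t
        simp [Δ, hfY _ (hδ t)]
      rw [hΓ, hΔ]
      exact hhom
  have h1 : Γ 1 = Δ 1 := hlift.some.fst_eq_snd (by simp)
  simp [Γ, Δ, hφb] at h1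

/-- A proper closed subset of the circle with at least two points contains two distinct points
that are the endpoints of a complementary arc. -/
theorem Circle.exists_ne_joinedIn_closure_compl {S : Set Circle} (hS : IsClosed S)
    (hnt : S.Nontrivial) (hne : S ≠ univ) :
    ∃ a ∈ S, ∃ b ∈ S, a ≠ b ∧ JoinedIn (closure Sᶜ) a b := by
  obtain ⟨z, hz⟩ := (ne_univ_iff_exists_notMem S).1 hne
  obtain ⟨t, rfl⟩ := Circle.exp_surjective z
  have hpi := Real.pi_pos
  set T : Set ℝ := Circle.exp ⁻¹' S with hT
  have hTc : IsClosed T := hS.preimage Circle.exp.continuous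
  have hlift : ∀ w ∈ S, ∃ s ∈ T, t < s ∧ s < t + 2 * Real.pi ∧ Circle.exp s = w := by
    intro w hw
    obtain ⟨s, hs⟩ := Circle.exp_surjective w
    obtain ⟨y, hy, hsy⟩ := Circle.periodic_exp.exists_mem_Ico (by positivity) s t
    have hyw : Circle.exp y = w := hsy ▸ hs
    refine ⟨y, by simpa [hT, hyw], lt_of_le_of_ne hy.1 ?_, hy.2, hyw⟩
    rintro rfl
    exact hz (hyw ▸ hw)
  obtain ⟨s, hs, r, hr, hts, hrt, hsr⟩ :
      ∃ s ∈ T, ∃ r ∈ T, t < s ∧ r < t + 2 * Real.pi ∧ s < r := by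
    obtain ⟨x, hx, y, hy, hxy⟩ := hnt
    obtain ⟨s, hs, h1, h2, rfl⟩ := hlift x hx
    obtain ⟨r, hr, h3, h4, rfl⟩ := hlift y hy
    rcases lt_trichotomy s r with h | h | h
    · exact ⟨s, hs, r, hr, h1, h4, h⟩
    · exact absurd (congrArg _ h) hxy
    · exact ⟨r, hr, s, hs, h3, h2, h⟩
  have hr' : r - 2 * Real.pi ∈ T := by simpa [hT, Circle.exp_sub_two_pi] using hr
  have hbB : BddBelow (T ∩ Ici t) := ⟨t, fun _ h => h.2⟩
  have haB : BddAbove (T ∩ Iic t) := ⟨t, fun _ h => h.2⟩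
  have hbm := (hTc.inter isClosed_Ici).csInf_mem ⟨s, hs, hts.le⟩ hbB
  have ham := (hTc.inter isClosed_Iic).csSup_mem ⟨_, hr', by simp only [mem_Iic]; linarith⟩ haB
  have hbs := csInf_le hbB ⟨hs, hts.le⟩
  have har := le_csSup haB ⟨hr', by simp only [mem_Iic]; linarith⟩
  have hbmin : ∀ x ∈ T, t ≤ x → sInf (T ∩ Ici t) ≤ x := fun x hx h => csInf_le hbB ⟨hx, h⟩
  have hamax : ∀ x ∈ T, x ≤ t → x ≤ sSup (T ∩ Iic t) := fun x hx h => le_csSup haB ⟨hx, h⟩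
  generalize sInf (T ∩ Ici t) = b at *
  generalize sSup (T ∩ Iic t) = a at *
  have htT : t ∉ T := hz
  have hat : a < t := lt_of_le_of_ne ham.2 fun h => htT (h ▸ ham.1)
  have htb : t < b := lt_of_le_of_ne hbm.2 fun h => htT (h ▸ hbm.1)
  have hab : a < b := hat.trans htb
  refine ⟨_, ham.1, _, hbm.1, fun h => hab.ne ?_, ?_⟩
  · exact Circle.exp_injOn_Icc (a := a) (b := b) (by linarith) ⟨le_rfl, hab.le⟩ ⟨hab.le, le_rfl⟩ h
  · have hsub : Circle.exp '' Icc a b ⊆ closure Sᶜ := by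
      rw [← closure_Ioo hab.ne]
      refine (image_closure_subset_closure_image Circle.exp.continuous).trans (closure_mono ?_)
      rintro _ ⟨x, hx, rfl⟩ hxS
      rcases le_total t x with h | h
      · exact hx.2.not_ge (hbmin x hxS h)
      · exact hx.1.not_ge (hamax x hxS h)
    exact (((convex_Icc a b).isPathConnected ⟨a, le_rfl, hab.le⟩).image
      Circle.exp.continuous).joinedIn _ ⟨a, ⟨le_rfl, hab.le⟩, rfl⟩ _ ⟨b, ⟨hab.le, le_rfl⟩, rfl⟩
      |>.mono hsub

/-- If finitely many topological balls in `ℝ^d` pairwise intersect in at most one point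
and their union is simply connected, then any simple closed curve in the union lies in
one of the balls. -/
theorem stmt_5 {d n : ℕ} (B : Fin n → Set (EuclideanSpace ℝ (Fin d)))
    (hball : ∀ i, Nonempty (B i ≃ₜ Metric.closedBall (0 : EuclideanSpace ℝ (Fin d)) 1))
    (hint : ∀ i j, i ≠ j → (B i ∩ B j).Subsingleton)
    (X : Set (EuclideanSpace ℝ (Fin d))) (hX : X = ⋃ i, B i)
    (hsc : SimplyConnectedSpace X)
    (C : Set (EuclideanSpace ℝ (Fin d))) (hC : C ⊆ X)
    (hcirc : Nonempty (C ≃ₜ Circle)) :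
    ∃ i, C ⊆ B i := by
  by_contra! hcon
  obtain ⟨e⟩ := hcirc
  have hclosed : ∀ i, IsClosed (B i) := by
    intro i
    obtain ⟨g⟩ := hball i
    have : CompactSpace (Metric.closedBall (0 : EuclideanSpace ℝ (Fin d)) 1) :=
      isCompact_iff_compactSpace.1 (isCompact_closedBall _ _)
    have : CompactSpace (B i) := g.symm.compactSpace
    exact (isCompact_iff_compactSpace.2 this).isClosed
  have hpath : ∀ i, IsPathConnected (B i) := by
    intro i
    obtain ⟨g⟩ := hball i
    have : PathConnectedSpace (Metric.closedBall (0 : EuclideanSpace ℝ (Fin d)) 1) :=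
      isPathConnected_iff_pathConnectedSpace.1
        ((convex_closedBall _ _).isPathConnected ⟨0, by simp⟩)
    exact isPathConnected_iff_pathConnectedSpace.2 (g.symm.surjective.pathConnectedSpace
      g.symm.continuous)
  let h : Circle → X := fun z => inclusion hC (e.symm z)
  have hhc : Continuous h := (continuous_inclusion hC).comp e.symm.continuous
  have hhi : Function.Injective h := (inclusion_injective hC).comp e.symm.injective
  obtain ⟨i, hi⟩ : ∃ i, (h ⁻¹' (Subtype.val ⁻¹' B i)).Nontrivial := by
    by_contra! hsub
    have hfin : (⋃ i, h ⁻¹' (Subtype.val ⁻¹' B i)).Finite :=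
      finite_iUnion fun i => (hsub i).finite
    have huniv : (⋃ i, h ⁻¹' (Subtype.val ⁻¹' B i)) = univ := by
      refine eq_univ_of_forall fun z => ?_
      have := hX.subset (h z).2
      simpa using this
    have hinf : (Circle.exp '' Icc 0 1).Infinite :=
      (Icc_infinite zero_lt_one).image (Circle.exp_injOn_Icc (by linarith [Real.pi_gt_three]))
    exact hinf ((huniv ▸ hfin).subset (subset_univ _))
  set K : Set X := Subtype.val ⁻¹' B i with hK
  set Y : Set X := Subtype.val ⁻¹' ⋃ j ∈ {j | j ≠ i}, B j
  have hKc : IsClosed K := (hclosed i).preimage continuous_subtype_val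
  have hYc : IsClosed Y :=
    ((toFinite _).isClosed_biUnion fun j _ => hclosed j).preimage continuous_subtype_val
  have hKY : K ∪ Y = univ := by
    refine eq_univ_of_forall fun z => ?_
    obtain ⟨j, hj⟩ := mem_iUnion.1 (hX.subset z.2)
    by_cases hji : j = i
    · subst hji
      exact Or.inl hj
    · exact Or.inr (mem_biUnion (s := {j | j ≠ i}) hji hj)
  have hfin : (K ∩ Y).Finite := by
    rw [← preimage_inter, inter_iUnion₂]
    exact ((toFinite _).biUnion fun j hj => (hint i j (Ne.symm hj)).finite).preimage
      Subtype.val_injective.injOn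
  have hne : h ⁻¹' K ≠ univ := by
    intro hu
    refine hcon i fun x hx => ?_
    have : e ⟨x, hx⟩ ∈ h ⁻¹' K := hu ▸ mem_univ _
    simpa [h, hK] using this
  obtain ⟨a, ha, b, hb, hab, hj⟩ :=
    Circle.exists_ne_joinedIn_closure_compl (hKc.preimage hhc) hi hne
  have hsub : closure (h ⁻¹' K)ᶜ ⊆ h ⁻¹' Y :=
    closure_minimal (fun z hz => (hKY.ge (mem_univ (h z))).resolve_left hz) (hYc.preimage hhc)
  have hKp : IsPathConnected K := by
    refine Topology.IsInducing.subtypeVal.isPathConnected_iff.2 ?_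
    rw [hK, Subtype.image_preimage_coe, inter_eq_right.2 (hX ▸ subset_iUnion B i)]
    exact hpath i
  exact hab <| hhi <| eq_of_joinedIn_of_joinedIn_of_finite_inter hKc hYc hKY hfin
    (hKp.joinedIn _ ha _ hb)
    ((hj.map hhc).mono (image_subset_iff.2 hsub))
end

section
/- Let S and S' be two contractible P-polyhedral systems of similarities for the same polyhedron P. Then the composed system S'' = {S_i ∘ S_j' : S_i ∈ S, S_j' ∈ S'} is also a contractible P-polyhedral system. -/
open Set

/-- `S` is a `P`-polyhedral system with vertex set `V`: the maps are contraction
similarities, each `Pᵢ = Sᵢ(P)` lies in `P`, distinct `Pᵢ, Pⱼ` meet in at most one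
point which is then a common vertex, and every vertex of `P` is a vertex of some
`Pᵢ`. -/
def IsPPolyhedralSystem {d : ℕ} {ι : Type*} (P : Set (EuclideanSpace ℝ (Fin d)))
    (V : Finset (EuclideanSpace ℝ (Fin d)))
    (S : ι → EuclideanSpace ℝ (Fin d) → EuclideanSpace ℝ (Fin d)) : Prop :=
  (∀ i, ∃ r ∈ Set.Ioo (0 : ℝ) 1, ∀ x y, dist (S i x) (S i y) = r * dist x y) ∧
  (∀ i, S i '' P ⊆ P) ∧
  (∀ i j, i ≠ j → (S i '' P ∩ S j '' P = ∅ ∨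
    ∃ v, S i '' P ∩ S j '' P = {v} ∧ v ∈ S i '' (V : Set (EuclideanSpace ℝ (Fin d))) ∧
      v ∈ S j '' (V : Set (EuclideanSpace ℝ (Fin d))))) ∧
  ((V : Set (EuclideanSpace ℝ (Fin d))) ⊆
    ⋃ i, S i '' (V : Set (EuclideanSpace ℝ (Fin d))))

/-- The polyhedron data: `P` is a compact set homeomorphic to the closed `d`-ball, with
finite vertex set `V ⊆ P`. -/
def IsPolyhedronWithVertices {d : ℕ} (P : Set (EuclideanSpace ℝ (Fin d)))
    (V : Finset (EuclideanSpace ℝ (Fin d))) : Prop :=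
  IsCompact P ∧ (V : Set (EuclideanSpace ℝ (Fin d))) ⊆ P ∧
    Nonempty (P ≃ₜ Metric.closedBall (0 : EuclideanSpace ℝ (Fin d)) 1)

/-- The composition `S_{j₁} ∘ ⋯ ∘ S_{jₙ}` associated to a multiindex `j`. -/
def Sw {d : ℕ} {ι : Type*} (S : ι → EuclideanSpace ℝ (Fin d) → EuclideanSpace ℝ (Fin d)) :
    List ι → EuclideanSpace ℝ (Fin d) → EuclideanSpace ℝ (Fin d) :=
  fun l => l.foldr (fun i f => S i ∘ f) id

/-- A contractible `P`-polyhedral system: conditions D1–D3 together with D4, the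
contractibility of `⋃ᵢ Sᵢ(P)`. -/
def IsContractiblePPolyhedralSystem {d : ℕ} {ι : Type*}
    (P : Set (EuclideanSpace ℝ (Fin d))) (V : Finset (EuclideanSpace ℝ (Fin d)))
    (S : ι → EuclideanSpace ℝ (Fin d) → EuclideanSpace ℝ (Fin d)) : Prop :=
  IsPPolyhedralSystem P V S ∧ ContractibleSpace ↥(⋃ i, S i '' P)

/-- A set `K` is a neighborhood retract of the ambient space. -/
def IsNhdRetract {E : Type*} [TopologicalSpace E] (K : Set E) : Prop :=
  ∃ U, IsOpen U ∧ K ⊆ U ∧ ∃ r : E → E, ContinuousOn r U ∧ MapsTo r U K ∧ EqOn r id K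

/-- A set `K` is a retract of the ambient space. -/
def IsRetractSet {E : Type*} [TopologicalSpace E] (K : Set E) : Prop :=
  ∃ r : E → E, Continuous r ∧ (∀ x, r x ∈ K) ∧ EqOn r id K

theorem ContractibleSpace.of_retract {X Y : Type*} [TopologicalSpace X] [TopologicalSpace Y]
    [ContractibleSpace X] (i : C(Y, X)) (r : C(X, Y)) (h : r.comp i = .id Y) :
    ContractibleSpace Y := by
  rw [contractible_iff_id_nullhomotopic, ← h]
  simpa using ((id_nullhomotopic X).comp_left i).comp_right r

theorem exists_continuousOn_piecewise {X Y : Type*} [TopologicalSpace X] {A B : Set X}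
    [TopologicalSpace Y] (hA : IsClosed A) (hB : IsClosed B) {f g : X → Y} {U : Set X}
    (hf : ContinuousOn f (A ∩ U)) (hg : ContinuousOn g (B ∩ U)) (hU : U ⊆ A ∪ B)
    (hfg : ∀ x ∈ U, x ∈ A → x ∈ B → f x = g x) :
    ∃ h : X → Y, ContinuousOn h U ∧ EqOn h f (A ∩ U) ∧ EqOn h g (B ∩ U) := by
  classical
  have hgB : EqOn (A.piecewise f g) g (B ∩ U) := by
    intro x hx
    by_cases hxA : x ∈ A
    · simp [hxA, hfg x hx.2 hxA hx.1]
    · simp [hxA]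
  have hfA : EqOn (A.piecewise f g) f (A ∩ U) := fun x hx => by simp [hx.1]
  refine ⟨A.piecewise f g, fun x hx => ?_, hfA, hgB⟩
  have key : ∀ {C : Set X}, IsClosed C → ContinuousOn (A.piecewise f g) (C ∩ U) →
      ContinuousWithinAt (A.piecewise f g) (C ∩ U) x := by
    intro C hC hc
    by_cases hxC : x ∈ C
    · exact hc x ⟨hxC, hx⟩
    · refine continuousWithinAt_of_notMem_closure fun hcl => hxC ?_
      exact hC.closure_subset (closure_mono inter_subset_left hcl)
  have := (key hA (hf.congr hfA)).union (key hB (hg.congr hgB))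
  exact this.mono fun y hy => (hU hy).imp (⟨·, hy⟩) (⟨·, hy⟩)

theorem IsRetractSet.isNhdRetract {E : Type*} [TopologicalSpace E] {K : Set E}
    (h : IsRetractSet K) : IsNhdRetract K := by
  obtain ⟨r, hr, hrK, hid⟩ := h
  exact ⟨univ, isOpen_univ, subset_univ _, r, hr.continuousOn, fun x _ => hrK x, hid⟩

theorem isNhdRetract_empty {E : Type*} [TopologicalSpace E] : IsNhdRetract (∅ : Set E) :=
  ⟨∅, isOpen_empty, subset_rfl, id, continuousOn_empty _, mapsTo_empty _ _, eqOn_empty _ _⟩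

theorem isNhdRetract_singleton {E : Type*} [TopologicalSpace E] (p : E) :
    IsNhdRetract ({p} : Set E) :=
  IsRetractSet.isNhdRetract ⟨fun _ => p, continuous_const, fun _ => rfl, by simp [EqOn]⟩

/-- A set which is itself a Tietze extension space is a retract. -/
theorem IsRetractSet.of_tietzeExtension {E : Type} [MetricSpace E] {K : Set E} (hK : IsClosed K)
    [TietzeExtension.{0, 0} K] : IsRetractSet K := by
  obtain ⟨g, hg⟩ := ContinuousMap.exists_restrict_eq hK (ContinuousMap.id K)
  refine ⟨fun x => g x, by fun_prop, fun x => (g x).2, fun x hx => ?_⟩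
  exact congrArg Subtype.val (DFunLike.congr_fun hg ⟨x, hx⟩)

/-- Maps from a closed set to a neighborhood retract extend to a neighborhood. -/
theorem IsNhdRetract.exists_extension {E : Type} [MetricSpace E] [TietzeExtension.{0, 0} E]
    {K C : Set E} (hK : IsNhdRetract K)
    (hC : IsClosed C) {f : E → E} (hf : ContinuousOn f C) (hfK : MapsTo f C K) :
    ∃ U, IsOpen U ∧ C ⊆ U ∧ ∃ g : E → E, ContinuousOn g U ∧ MapsTo g U K ∧ EqOn g f C := by
  obtain ⟨U, hU, hKU, r, hr, hrK, hid⟩ := hK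
  obtain ⟨F, hF⟩ := ContinuousMap.exists_restrict_eq hC ⟨_, hf.domRestrict⟩
  have hF' : EqOn F f C := fun x hx => DFunLike.congr_fun hF ⟨x, hx⟩
  refine ⟨F ⁻¹' U, hU.preimage F.continuous, fun x hx => ?_, r ∘ F,
    hr.comp F.continuous.continuousOn fun x hx => hx, fun x hx => hrK hx, fun x hx => ?_⟩
  · rw [mem_preimage, hF' hx]
    exact hKU (hfK hx)
  · rw [Function.comp_apply, hF' hx]
    exact hid (hfK hx)

section NhdRetract

variable {E : Type} [MetricSpace E] [TietzeExtension.{0, 0} E]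

/-- The union of two closed neighborhood retracts whose intersection is a neighborhood retract
is a neighborhood retract. -/
theorem IsNhdRetract.union {A B : Set E} (hA : IsNhdRetract A) (hB : IsNhdRetract B)
    (hAB : IsNhdRetract (A ∩ B)) (cA : IsClosed A) (cB : IsClosed B) : IsNhdRetract (A ∪ B) := by
  obtain ⟨U₀, hU₀, hABU₀, r₀, hr₀, hr₀AB, hid₀⟩ := hAB
  obtain ⟨W, hW, hABW, hWU₀⟩ := normal_exists_closure_subset (cA.inter cB) hU₀ hABU₀
  set CA : Set E := {x | Metric.infEDist x A ≤ Metric.infEDist x B} with hCA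
  set CB : Set E := {x | Metric.infEDist x B ≤ Metric.infEDist x A} with hCB
  have cCA : IsClosed CA := isClosed_le Metric.continuous_infEDist Metric.continuous_infEDist
  have cCB : IsClosed CB := isClosed_le Metric.continuous_infEDist Metric.continuous_infEDist
  have hACA : A ⊆ CA := fun x hx => by simp [hCA, Metric.infEDist_zero_of_mem hx]
  have hBCB : B ⊆ CB := fun x hx => by simp [hCB, Metric.infEDist_zero_of_mem hx]
  have hACB : A ∩ CB ⊆ A ∩ B := fun x hx => ⟨hx.1, by
    have h := hx.2
    simp only [hCB, mem_ofPred_eq, Metric.infEDist_zero_of_mem hx.1, nonpos_iff_eq_zero] at h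
    exact (Metric.mem_iff_infEDist_zero_of_closed cB).2 h⟩
  have hBCA : B ∩ CA ⊆ A ∩ B := fun x hx => ⟨by
    have h := hx.2
    simp only [hCA, mem_ofPred_eq, Metric.infEDist_zero_of_mem hx.1, nonpos_iff_eq_zero] at h
    exact (Metric.mem_iff_infEDist_zero_of_closed cA).2 h, hx.1⟩
  set N : Set E := CA ∩ CB ∩ closure W
  have cN : IsClosed N := (cCA.inter cCB).inter isClosed_closure
  have hr₀N : ContinuousOn r₀ N := hr₀.mono fun x hx => hWU₀ hx.2
  have ext : ∀ {K : Set E}, IsNhdRetract K → IsClosed K → A ∩ B ⊆ K → K ∩ N ⊆ A ∩ B →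
      ∃ U, IsOpen U ∧ K ∪ N ⊆ U ∧ ∃ g : E → E, ContinuousOn g U ∧ MapsTo g U K ∧
        EqOn g id K ∧ EqOn g r₀ N := by
    intro K hK cK hABK hKN
    obtain ⟨f, hf, hfK, hfN⟩ := exists_continuousOn_piecewise (U := K ∪ N) cK cN
      (f := id) (g := r₀) continuousOn_id (hr₀N.mono inter_subset_left) subset_rfl
      (fun x _ hxK hxN => (hid₀ (hKN ⟨hxK, hxN⟩)).symm)
    have hfK' : EqOn f id K := fun x hx => hfK ⟨hx, .inl hx⟩
    have hfN' : EqOn f r₀ N := fun x hx => hfN ⟨hx, .inr hx⟩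
    obtain ⟨U, hU, hKU, g, hg, hgK, hgf⟩ := hK.exists_extension (cK.union cN) hf (by
      rintro x (hx | hx)
      · simpa [hfK' hx] using hx
      · rw [hfN' hx]
        exact hABK (hr₀AB (hWU₀ hx.2)))
    exact ⟨U, hU, hKU, g, hg, hgK, fun x hx => (hgf (.inl hx)).trans (hfK' hx),
      fun x hx => (hgf (.inr hx)).trans (hfN' hx)⟩
  obtain ⟨UA, hUA, hAUA, gA, cgA, mgA, igA, ngA⟩ := ext hA cA inter_subset_left
    fun x hx => hACB ⟨hx.1, hx.2.1.2⟩
  obtain ⟨UB, hUB, hBUB, gB, cgB, mgB, igB, ngB⟩ := ext hB cB inter_subset_right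
    fun x hx => hBCA ⟨hx.1, hx.2.1.1⟩
  set U : Set E := (UA ∪ CAᶜ) ∩ (UB ∪ CBᶜ) ∩ (W ∪ (CA ∩ CB)ᶜ)
  have hUAs : CA ∩ U ⊆ UA := fun x hx => hx.2.1.1.resolve_right (not_not.2 hx.1)
  have hUBs : CB ∩ U ⊆ UB := fun x hx => hx.2.1.2.resolve_right (not_not.2 hx.1)
  have hcover : U ⊆ CA ∪ CB := fun x _ =>
    (le_total (Metric.infEDist x A) (Metric.infEDist x B)).imp id id
  obtain ⟨r, cr, rA, rB⟩ := exists_continuousOn_piecewise (U := U) cCA cCB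
    (cgA.mono hUAs) (cgB.mono hUBs) hcover (fun x hx hxA hxB => by
      have hxN : x ∈ N := ⟨⟨hxA, hxB⟩, subset_closure (hx.2.resolve_right (not_not.2 ⟨hxA, hxB⟩))⟩
      rw [ngA hxN, ngB hxN])
  have hABU : A ∪ B ⊆ U := by
    rintro x (hx | hx)
    · refine ⟨⟨.inl (hAUA (.inl hx)), ?_⟩, ?_⟩
      · by_cases h : x ∈ CB
        · exact .inl (hBUB (.inl (hACB ⟨hx, h⟩).2))
        · exact .inr h
      · by_cases h : x ∈ CB
        · exact .inl (hABW (hACB ⟨hx, h⟩))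
        · exact .inr fun h' => h h'.2
    · refine ⟨⟨?_, .inl (hBUB (.inl hx))⟩, ?_⟩
      · by_cases h : x ∈ CA
        · exact .inl (hAUA (.inl (hBCA ⟨hx, h⟩).1))
        · exact .inr h
      · by_cases h : x ∈ CA
        · exact .inl (hABW (hBCA ⟨hx, h⟩))
        · exact .inr fun h' => h h'.1
  refine ⟨U, ?_, hABU, r, cr, fun x hx => ?_, ?_⟩
  · exact ((hUA.union cCA.isOpen_compl).inter (hUB.union cCB.isOpen_compl)).inter
      (hW.union (cCA.inter cCB).isOpen_compl)
  · rcases hcover hx with h | h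
    · rw [rA ⟨h, hx⟩]
      exact .inl (mgA (hUAs ⟨h, hx⟩))
    · rw [rB ⟨h, hx⟩]
      exact .inr (mgB (hUBs ⟨h, hx⟩))
  · rintro x (hx | hx)
    · rw [rA ⟨hACA hx, hABU (.inl hx)⟩, igA hx]
    · rw [rB ⟨hBCB hx, hABU (.inr hx)⟩, igB hx]

theorem Set.Finite.isNhdRetract {F : Set E} (hF : F.Finite) : IsNhdRetract F := by
  induction F, hF using Set.Finite.induction_on with
  | empty => exact isNhdRetract_empty
  | @insert a s ha hs ih =>
    rw [insert_eq]
    refine (isNhdRetract_singleton a).union ih ?_ isClosed_singleton hs.isClosed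
    rw [singleton_inter_eq_empty.2 ha]
    exact isNhdRetract_empty

/-- A finite union of closed neighborhood retracts with pairwise finite intersections is a
neighborhood retract. -/
theorem isNhdRetract_iUnion {ι : Type*} [Finite ι] {K : ι → Set E} (cK : ∀ i, IsClosed (K i))
    (hK : ∀ i, IsNhdRetract (K i)) (hfin : ∀ i j, i ≠ j → (K i ∩ K j).Finite) :
    IsNhdRetract (⋃ i, K i) := by
  suffices h : ∀ s : Set ι, s.Finite → IsNhdRetract (⋃ i ∈ s, K i) by
    simpa using h univ finite_univ
  intro s hs
  induction s, hs using Set.Finite.induction_on with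
  | empty => simpa using isNhdRetract_empty
  | @insert a s ha hs ih =>
    rw [biUnion_insert]
    refine (hK a).union ih (Set.Finite.isNhdRetract ?_) (cK a)
      (hs.isClosed_biUnion fun i _ => cK i)
    rw [inter_iUnion₂]
    exact hs.biUnion fun i hi => hfin a i fun h => ha (h ▸ hi)

end NhdRetract

/-- A closed contractible neighborhood retract is a retract. -/
theorem IsNhdRetract.isRetractSet {E : Type*} [MetricSpace E] {K : Set E}
    (hK : IsNhdRetract K) (cK : IsClosed K)
    [ContractibleSpace K] : IsRetractSet K := by
  classical
  obtain ⟨U, hU, hKU, r, hr, hrK, hid⟩ := hK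
  obtain ⟨W, hW, hKW, hWU⟩ := normal_exists_closure_subset cK hU hKU
  obtain ⟨p, ⟨H⟩⟩ := id_nullhomotopic K
  obtain ⟨φ, hφ0, hφ1, hφI⟩ := exists_continuous_zero_one_of_isClosed cK hW.isClosed_compl
    (disjoint_compl_right_iff_subset.2 hKW)
  let f : E → E := fun x => if h : r x ∈ K then H (⟨φ x, hφI x⟩, ⟨r x, h⟩) else p
  have hf_eq : ∀ {x} (h : r x ∈ K), f x = H (⟨φ x, hφI x⟩, ⟨r x, h⟩) := fun h => dif_pos h
  have hf : ContinuousOn f (closure W) := by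
    rw [continuousOn_iff_continuous_domRestrict]
    have hrW : Continuous fun x : closure W => r x := (hr.mono hWU).domRestrict
    have : (closure W).domRestrict f = fun x : closure W =>
        (H (⟨φ x, hφI x⟩, ⟨r x, hrK (hWU x.2)⟩) : E) := funext fun x => hf_eq (hrK (hWU x.2))
    rw [this]
    exact continuous_subtype_val.comp (H.continuous.comp
      (((φ.continuous.comp continuous_subtype_val).subtype_mk _).prodMk (hrW.subtype_mk _)))
  obtain ⟨g, hg, hgW, hgc⟩ := exists_continuousOn_piecewise (U := univ) (f := f)
    (g := fun _ => (p : E)) isClosed_closure hW.isClosed_compl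
    (hf.mono inter_subset_left) continuousOn_const
    (fun x _ => by
      by_cases h : x ∈ W
      · exact .inl (subset_closure h)
      · exact .inr h)
    (fun x _ hx hxW => by
      have h1 : (⟨φ x, hφI x⟩ : unitInterval) = 1 := Subtype.ext (hφ1 hxW)
      rw [hf_eq (hrK (hWU hx)), h1, H.apply_one]
      rfl)
  refine ⟨g, continuousOn_univ.1 hg, fun x => ?_, fun x hx => ?_⟩
  · by_cases h : x ∈ W
    · have hx := subset_closure h
      rw [hgW ⟨hx, mem_univ _⟩, hf_eq (hrK (hWU hx))]
      exact Subtype.coe_prop _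
    · rw [hgc ⟨h, mem_univ _⟩]
      exact p.2
  · have hxW := subset_closure (hKW hx)
    have h0 : (⟨φ x, hφI x⟩ : unitInterval) = 0 := Subtype.ext (hφ0 hx)
    rw [hgW ⟨hxW, mem_univ _⟩, hf_eq (hrK (hWU hxW)), h0, H.apply_zero]
    exact hid hx

theorem isEmbedding_of_dist_eq_mul {X Y : Type*} [MetricSpace X] [MetricSpace Y] {f : X → Y}
    {r : ℝ} (hr : 0 < r) (h : ∀ x y, dist (f x) (f y) = r * dist x y) :
    Topology.IsEmbedding f :=
  Dilation.isEmbedding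
    (Dilation.mkOfDistEq f ⟨⟨r, hr.le⟩, fun h0 => hr.ne' (congrArg NNReal.toReal h0), h⟩)

/-- If `Q` is a retract and the images of `P` under the embeddings `S i` overlap only in images of
points of `Q`, then contractibility of the union of the images of `P` passes to the union of the
images of `Q`. -/
theorem contractibleSpace_iUnion_image {E : Type*} [MetricSpace E] {ι : Type*} [Finite ι]
    {P Q : Set E} {S : ι → E → E} (hS : ∀ i, Topology.IsEmbedding (S i)) (hP : IsCompact P)
    (hQP : Q ⊆ P) (hQ : IsRetractSet Q)
    (hoverlap : ∀ i j, i ≠ j → S i '' P ∩ S j '' P ⊆ S i '' Q ∩ S j '' Q)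
    [ContractibleSpace ↥(⋃ i, S i '' P)] : ContractibleSpace ↥(⋃ i, S i '' Q) := by
  obtain ⟨g, hg, hgQ, hid⟩ := hQ
  have hex : ∀ x, ∃ y, ∀ i, ∀ a ∈ P, S i a = x → S i (g a) = y := by
    intro x
    by_cases hx : ∃ i, ∃ a ∈ P, S i a = x
    · obtain ⟨i, a, ha, rfl⟩ := hx
      refine ⟨S i (g a), fun j b hb hab => ?_⟩
      by_cases hij : i = j
      · subst hij
        rw [(hS i).injective hab]
      · obtain ⟨⟨a', ha', haa'⟩, b', hb', hbb'⟩ :=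
          hoverlap i j hij ⟨⟨a, ha, rfl⟩, b, hb, hab⟩
        obtain rfl := (hS i).injective haa'
        obtain rfl := (hS j).injective (hbb'.trans hab.symm)
        rw [hid ha', hid hb', id, id, hab]
    · exact ⟨x, fun i a ha h => (hx ⟨i, a, ha, h⟩).elim⟩
  choose R hR using hex
  have hRS : ∀ i, ∀ a ∈ P, R (S i a) = S i (g a) := fun i a ha => (hR _ i a ha rfl).symm
  have hRc : ContinuousOn R (⋃ i, S i '' P) := by
    refine (locallyFinite_of_finite _).continuousOn_iUnion
      (fun i => (hP.image (hS i).continuous).isClosed) fun i => ?_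
    rintro _ ⟨a, ha, rfl⟩
    rw [ContinuousWithinAt, ← (hS i).map_nhdsWithin_eq, Filter.tendsto_map'_iff, hRS i a ha]
    refine (((hS i).continuous.comp hg).continuousWithinAt (s := P)).tendsto.congr' ?_
    filter_upwards [self_mem_nhdsWithin] with x hx using (hRS i x hx).symm
  have hmaps : ∀ x ∈ ⋃ i, S i '' P, R x ∈ ⋃ i, S i '' Q := by
    intro x hx
    obtain ⟨i, a, ha, rfl⟩ := mem_iUnion.1 hx
    rw [hRS i a ha]
    exact mem_iUnion.2 ⟨i, g a, hgQ a, rfl⟩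
  have hsub : (⋃ i, S i '' Q) ⊆ ⋃ i, S i '' P := iUnion_mono fun i => image_mono hQP
  refine ContractibleSpace.of_retract ⟨inclusion hsub, continuous_inclusion hsub⟩
    ⟨fun x => ⟨R x, hmaps x x.2⟩, hRc.domRestrict.subtype_mk _⟩ ?_
  ext x
  obtain ⟨x, hx⟩ := x
  obtain ⟨i, a, ha, rfl⟩ := mem_iUnion.1 hx
  change R (S i a) = S i a
  rw [hRS i a (hQP ha), hid ha, id]

section PolyhedralSystem

variable {d : ℕ} {ι ι' : Type*} {P : Set (EuclideanSpace ℝ (Fin d))}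
  {V : Finset (EuclideanSpace ℝ (Fin d))}
  {S : ι → EuclideanSpace ℝ (Fin d) → EuclideanSpace ℝ (Fin d)}
  {S' : ι' → EuclideanSpace ℝ (Fin d) → EuclideanSpace ℝ (Fin d)}

theorem IsPPolyhedralSystem.isEmbedding (hS : IsPPolyhedralSystem P V S) (i : ι) :
    Topology.IsEmbedding (S i) := by
  obtain ⟨r, hr, h⟩ := hS.1 i
  exact isEmbedding_of_dist_eq_mul hr.1 h

/-- A vertex of `P` lying in a piece of the system is a vertex of that piece. -/
theorem IsPPolyhedralSystem.mem_image_vertices (hS : IsPPolyhedralSystem P V S)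
    (hV : (V : Set (EuclideanSpace ℝ (Fin d))) ⊆ P) {i : ι} {a : EuclideanSpace ℝ (Fin d)}
    (ha : a ∈ V) (hai : a ∈ S i '' P) : a ∈ S i '' (V : Set (EuclideanSpace ℝ (Fin d))) := by
  obtain ⟨j, hj⟩ := mem_iUnion.1 (hS.2.2.2 ha)
  by_cases hij : i = j
  · exact hij ▸ hj
  have hmem : a ∈ S i '' P ∩ S j '' P := ⟨hai, image_mono hV hj⟩
  rcases hS.2.2.1 i j hij with h | ⟨v, h, hvi, -⟩
  · simp [h] at hmem
  · rw [h, mem_singleton_iff] at hmem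
    exact hmem ▸ hvi

theorem IsPPolyhedralSystem.comp (hS : IsPPolyhedralSystem P V S)
    (hS' : IsPPolyhedralSystem P V S') (hV : (V : Set (EuclideanSpace ℝ (Fin d))) ⊆ P) :
    IsPPolyhedralSystem P V (fun p : ι × ι' => S p.1 ∘ S' p.2) := by
  refine ⟨fun p => ?_, fun p => ?_, ?_, fun a ha => ?_⟩
  · obtain ⟨r, hr, h⟩ := hS.1 p.1
    obtain ⟨r', hr', h'⟩ := hS'.1 p.2
    refine ⟨r * r', ⟨mul_pos hr.1 hr'.1, mul_lt_one_of_nonneg_of_lt_one_left hr.1.le hr.2 hr'.2.le⟩,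
      fun x y => ?_⟩
    simp [h, h', mul_assoc]
  · rw [image_comp]
    exact (image_mono (hS'.2.1 p.2)).trans (hS.2.1 p.1)
  · rintro ⟨i, j⟩ ⟨k, l⟩ hne
    simp only [image_comp]
    by_cases hik : i = k
    · subst hik
      have hjl : j ≠ l := fun h => hne (by rw [h])
      rw [← image_inter (hS.isEmbedding i).injective]
      rcases hS'.2.2.1 j l hjl with h | ⟨v, h, hv, hv'⟩
      · exact .inl (by rw [h, image_empty])
      · exact .inr ⟨S i v, by rw [h, image_singleton], mem_image_of_mem _ hv,
          mem_image_of_mem _ hv'⟩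
    · rcases eq_empty_or_nonempty (S i '' (S' j '' P) ∩ S k '' (S' l '' P)) with h | ⟨v, hv, hv'⟩
      · exact .inl h
      have hsub := inter_subset_inter (image_mono (f := S i) (hS'.2.1 j))
        (image_mono (f := S k) (hS'.2.1 l))
      have hvert : ∀ {n q}, v ∈ S n '' (V : Set (EuclideanSpace ℝ (Fin d))) →
          v ∈ S n '' (S' q '' P) →
          v ∈ S n '' (S' q '' (V : Set (EuclideanSpace ℝ (Fin d)))) := by
        rintro n q ⟨a, ha, rfl⟩ h
        refine mem_image_of_mem _ (hS'.mem_image_vertices hV ha ?_)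
        exact (hS.isEmbedding n).injective.mem_set_image.1 h
      rcases hS.2.2.1 i k hik with h | ⟨w, h, hw, hw'⟩
      · exact (notMem_empty v (h ▸ hsub ⟨hv, hv'⟩)).elim
      · rw [h] at hsub
        obtain rfl : v = w := hsub ⟨hv, hv'⟩
        exact .inr ⟨v, subset_antisymm hsub (singleton_subset_iff.2 ⟨hv, hv'⟩),
          hvert hw hv, hvert hw' hv'⟩
  · obtain ⟨i, b, hb, rfl⟩ := mem_iUnion.1 (hS.2.2.2 ha)
    obtain ⟨j, c, hc, rfl⟩ := mem_iUnion.1 (hS'.2.2.2 hb)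
    exact mem_iUnion.2 ⟨(i, j), c, hc, rfl⟩

/-- The union of the pieces of a contractible polyhedral system is a retract of the ambient
space. -/
theorem IsContractiblePPolyhedralSystem.isRetractSet [Finite ι]
    (hP : IsPolyhedronWithVertices P V) (hS : IsContractiblePPolyhedralSystem P V S) :
    IsRetractSet (⋃ i, S i '' P) := by
  obtain ⟨cP, -, ⟨e⟩⟩ := hP
  obtain ⟨hS, hcontr⟩ := hS
  have hclosed : ∀ i, IsClosed (S i '' P) := fun i =>
    (cP.image (hS.isEmbedding i).continuous).isClosed
  refine (isNhdRetract_iUnion hclosed (fun i => ?_) fun i j hij => ?_).isRetractSet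
    (isClosed_iUnion_of_finite hclosed)
  · have : TietzeExtension.{0, 0} (Metric.closedBall (0 : EuclideanSpace ℝ (Fin d)) 1) :=
      Set.instTietzeExtensionUnitClosedBall (𝕜 := ℝ)
    have : TietzeExtension.{0, 0} (S i '' P) :=
      .of_homeo (((hS.isEmbedding i).homeomorphImage P).symm.trans e)
    exact (IsRetractSet.of_tietzeExtension (hclosed i)).isNhdRetract
  · rcases hS.2.2.1 i j hij with h | ⟨v, h, -⟩ <;> simp [h]

end PolyhedralSystem

/-- The composition of two contractible `P`-polyhedral systems is again a contractible
`P`-polyhedral system. -/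
theorem stmt_12 {d m m' : ℕ} (P : Set (EuclideanSpace ℝ (Fin d)))
    (V : Finset (EuclideanSpace ℝ (Fin d)))
    (S : Fin m → EuclideanSpace ℝ (Fin d) → EuclideanSpace ℝ (Fin d))
    (S' : Fin m' → EuclideanSpace ℝ (Fin d) → EuclideanSpace ℝ (Fin d))
    (hP : IsPolyhedronWithVertices P V)
    (hS : IsContractiblePPolyhedralSystem P V S)
    (hS' : IsContractiblePPolyhedralSystem P V S') :
    IsContractiblePPolyhedralSystem P V
      (fun p : Fin m × Fin m' => S p.1 ∘ S' p.2) := by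

  refine ⟨hS.1.comp hS'.1 hP.2.1, ?_⟩
  have hretract := hS'.isRetractSet hP
  have hQP : (⋃ j, S' j '' P) ⊆ P := iUnion_subset hS'.1.2.1
  have hVQ : (V : Set (EuclideanSpace ℝ (Fin d))) ⊆ ⋃ j, S' j '' P :=
    hS'.1.2.2.2.trans (iUnion_mono fun j => image_mono hP.2.1)
  have := hS.2
  have hcontr := contractibleSpace_iUnion_image hS.1.isEmbedding hP.1 hQP hretract
    fun i j hij => by
      rcases hS.1.2.2.1 i j hij with h | ⟨v, h, hvi, hvj⟩ <;> rw [h]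
      · exact empty_subset _
      · exact singleton_subset_iff.2 ⟨image_mono hVQ hvi, image_mono hVQ hvj⟩
  have heq : (⋃ p : Fin m × Fin m', (S p.1 ∘ S' p.2) '' P) = ⋃ i, S i '' ⋃ j, S' j '' P := by
    simp only [image_iUnion, image_comp]
    exact iUnion_prod' fun p : Fin m × Fin m' => S p.1 '' (S' p.2 '' P)
  rwa [heq]
end

section
/- Let S be a contractible P-polyhedral system of similarities. Then its attractor K is a dendrite, i.e., a locally connected continuum containing no simple closed curve. -/
open Set

/-- A compact set covered by its own images under contractions lies in every nonempty compact set
that the contractions preserve. -/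
theorem subset_of_subset_iUnion_image_of_contraction {X ι : Type*} [MetricSpace X]
    {S : ι → X → X} {R : ℝ} (hR : R < 1)
    (hS : ∀ i x y, dist (S i x) (S i y) ≤ R * dist x y) {A B : Set X} (hA : IsCompact A)
    (hAS : A ⊆ ⋃ i, S i '' A) (hB : IsCompact B) (hBne : B.Nonempty)
    (hBS : ∀ i, S i '' B ⊆ B) : A ⊆ B := by
  rcases A.eq_empty_or_nonempty with rfl | hAne
  · exact empty_subset _
  obtain ⟨x, hxA, hx⟩ := hA.exists_isMaxOn hAne (Metric.continuous_infDist_pt B).continuousOn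
  obtain ⟨i, y, hyA, rfl⟩ := mem_iUnion.1 (hAS hxA)
  obtain ⟨b, hb, hyb⟩ := hB.exists_infDist_eq_dist hBne y
  have h1 : Metric.infDist (S i y) B ≤ R * Metric.infDist y B :=
    (Metric.infDist_le_dist_of_mem (hBS i ⟨b, hb, rfl⟩)).trans (hyb ▸ hS i y b)
  have h2 : Metric.infDist y B ≤ Metric.infDist (S i y) B := hx hyA
  have h3 : 0 ≤ Metric.infDist y B := Metric.infDist_nonneg
  have h4 : Metric.infDist (S i y) B ≤ 0 := by
    rcases h3.eq_or_lt with h | h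
    · rwa [← h, mul_zero] at h1
    · nlinarith
  intro z hz
  have h5 : Metric.infDist z B ≤ Metric.infDist (S i y) B := hx hz
  exact (hB.isClosed.mem_iff_infDist_zero hBne).2 (le_antisymm (h5.trans h4) Metric.infDist_nonneg)

/-- A continuous map from a contractible space to the circle has a continuous logarithm. -/
theorem exists_lift_circle_of_contractible {X : Type*} [TopologicalSpace X] [ContractibleSpace X]
    (f : C(X, Circle)) : ∃ h : C(X, ℝ), ∀ x, Circle.exp (h x) = f x := by
  obtain ⟨y, ⟨H⟩⟩ := (id_nullhomotopic X).comp_right f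
  obtain ⟨θ, hθ⟩ : ∃ θ : ℝ, Circle.exp θ = y := ⟨_, Circle.exp_arg y⟩
  have H_0 : ∀ a, H.symm.toContinuousMap (0, a) = Circle.exp (ContinuousMap.const X θ a) := by
    intro a
    simp [hθ]
  let L := Circle.isCoveringMap_exp.liftHomotopy H.symm.toContinuousMap (.const X θ) H_0
  refine ⟨L.comp ((ContinuousMap.const X 1).prodMk (.id X)), fun x => ?_⟩
  have := congr_fun (Circle.isCoveringMap_exp.liftHomotopy_lifts H.symm.toContinuousMap _ H_0) (1, x)
  refine this.trans ?_
  simp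

/-- Two logarithms of the same circle-valued map differ by a constant on a preconnected set. -/
theorem IsPreconnected.sub_eq_sub_of_circleExp_eqOn {X : Type*} [TopologicalSpace X] {D : Set X}
    (hD : IsPreconnected D) {g h : X → ℝ} (hg : ContinuousOn g D) (hh : ContinuousOn h D)
    (hgh : ∀ x ∈ D, Circle.exp (g x) = Circle.exp (h x)) {p q : X} (hp : p ∈ D) (hq : q ∈ D) :
    g p - g q = h p - h q := by
  have := Circle.isCoveringMap_exp.eqOn_of_comp_eqOn hD hg
    (hh.add (continuousOn_const (c := g q - h q)))
    (fun x hx => by simp [Circle.exp_add, Circle.exp_sub, hgh x hx, hgh q hq]) hq (by simp) hp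
  simp only [Pi.add_apply] at this
  linarith

/-- If a contractible space is covered by closed sets `A` and `B` with finite intersection and `A`
preconnected, then each preconnected subset of `B` meets `A` in at most one point. -/
theorem eq_of_mem_inter_of_contractible {X : Type*} [TopologicalSpace X] [T4Space X]
    [ContractibleSpace X] {A B D : Set X} (hA : IsClosed A) (hB : IsClosed B)
    (hAB : A ∪ B = univ) (hAc : IsPreconnected A) (hfin : (A ∩ B).Finite) (hDB : D ⊆ B)
    (hD : IsPreconnected D) {p q : X} (hp : p ∈ A ∩ D) (hq : q ∈ A ∩ D) : p = q := by
  by_contra hpq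
  obtain ⟨g, hg0, hg1, -⟩ := exists_continuous_zero_one_of_isClosed
    (s := (A ∩ B) \ {q}) (t := {q}) (hfin.subset sdiff_subset).isClosed isClosed_singleton
    disjoint_sdiff_left
  have hgB : ∀ x ∈ A ∩ B, Circle.exp (2 * Real.pi * g x) = 1 := by
    intro x hx
    by_cases hxq : x = q
    · simp [hxq, hg1 (mem_singleton q)]
    · simp [hg0 ⟨hx, hxq⟩]
  classical
  let f : X → Circle := fun x => if x ∈ A then Circle.exp (2 * Real.pi * g x) else 1
  have hfA : EqOn f (fun x => Circle.exp (2 * Real.pi * g x)) A := fun x hx => if_pos hx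
  have hfB : EqOn f (fun _ => 1) B := by
    intro x hx
    by_cases hxA : x ∈ A
    · exact (if_pos hxA).trans (hgB x ⟨hxA, hx⟩)
    · exact if_neg hxA
  have hf : Continuous f := by
    rw [← continuousOn_univ, ← hAB]
    refine ContinuousOn.union_of_isClosed ?_ ?_ hA hB
    · exact ContinuousOn.congr (by fun_prop) hfA
    · exact continuousOn_const.congr hfB
  obtain ⟨h, hh⟩ := exists_lift_circle_of_contractible ⟨f, hf⟩
  have h1 := hAc.sub_eq_sub_of_circleExp_eqOn (g := h) (h := fun x => 2 * Real.pi * g x)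
    (by fun_prop) (by fun_prop) (fun x hx => (hh x).trans (hfA hx)) hp.1 hq.1
  have h2 := hD.sub_eq_sub_of_circleExp_eqOn (g := h) (h := fun _ => 0)
    (by fun_prop) (by fun_prop) (fun x hx => (hh x).trans (by simpa using hfB (hDB hx))) hp.2 hq.2
  rw [h2, hg1 (mem_singleton q), hg0 ⟨⟨hp.1, hDB hp.2⟩, hpq⟩] at h1
  simp at h1

/-- Version of `eq_of_mem_inter_of_contractible` for subsets of an ambient metric space. -/
theorem eq_of_mem_inter_of_contractible_union {X : Type*} [MetricSpace X] {A B D : Set X}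
    (hA : IsClosed A) (hB : IsClosed B) (hc : ContractibleSpace ↥(A ∪ B))
    (hAc : IsPreconnected A) (hfin : (A ∩ B).Finite) (hDB : D ⊆ B)
    (hD : IsPreconnected D) {p q : X} (hp : p ∈ A ∩ D) (hq : q ∈ A ∩ D) : p = q := by
  have pre : ∀ {T : Set X}, T ⊆ A ∪ B → IsPreconnected T →
      IsPreconnected ((↑) ⁻¹' T : Set ↥(A ∪ B)) := fun hT h => by
    rw [← Topology.IsInducing.subtypeVal.isPreconnected_image]
    rwa [Subtype.image_preimage_coe, inter_eq_right.2 hT]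
  have := eq_of_mem_inter_of_contractible (X := ↥(A ∪ B)) (A := Subtype.val ⁻¹' A)
    (B := Subtype.val ⁻¹' B) (D := Subtype.val ⁻¹' D) (p := ⟨p, .inl hp.1⟩) (q := ⟨q, .inl hq.1⟩)
    (hA.preimage continuous_subtype_val) (hB.preimage continuous_subtype_val)
    (eq_univ_of_forall fun x => x.2) (pre subset_union_left hAc)
    (by rw [← preimage_inter]; exact hfin.preimage Subtype.val_injective.injOn)
    (preimage_mono hDB) (pre (hDB.trans subset_union_right) hD) hp hq
  exact congrArg Subtype.val this

/-- A topological circle in `A ∪ B` meeting both `A \ B` and `B \ A` contains a connected subset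
of `B` that joins two different points of `A`. -/
theorem exists_preconnected_subset_of_circle {X : Type*} [TopologicalSpace X] {A B C : Set X}
    (hA : IsClosed A) (hB : IsClosed B) (hC : C ⊆ A ∪ B) (e : C ≃ₜ Circle)
    {x y : X} (hx : x ∈ C) (hxA : x ∉ A) (hy : y ∈ C) (hyB : y ∉ B) :
    ∃ D ⊆ B, IsPreconnected D ∧ ∃ p ∈ A ∩ D, ∃ q ∈ A ∩ D, p ≠ q := by
  let φ : ℝ → X := fun t => e.symm (e ⟨y, hy⟩ * Circle.exp t)
  have hφ : Continuous φ := by fun_prop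
  have hφC : ∀ t, φ t ∈ C := fun t => (e.symm _).2
  have hφinj : ∀ s t, φ s = φ t → Circle.exp s = Circle.exp t := fun s t hst =>
    mul_left_cancel (e.symm.injective (Subtype.ext hst))
  have hyA : y ∈ A := (hC hy).resolve_right hyB
  have hφ0 : φ 0 = y := by simp [φ]
  have hφ1 : φ (2 * Real.pi) = y := by simp [φ]
  obtain ⟨t, ht0, ht1, htx⟩ : ∃ t, 0 ≤ t ∧ t ≤ 2 * Real.pi ∧ φ t = x := by
    obtain ⟨t, ht, hte⟩ := (Circle.periodic_exp.exists_mem_Ico₀ Real.two_pi_pos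
      (Complex.arg ((e ⟨y, hy⟩)⁻¹ * e ⟨x, hx⟩ : Circle)))
    refine ⟨t, ht.1, ht.2.le, ?_⟩
    simp only [φ, ← hte, Circle.exp_arg, mul_inv_cancel_left, Homeomorph.symm_apply_apply]
  let Z := φ ⁻¹' A
  have hZ : IsClosed Z := hA.preimage hφ
  have htZ : t ∉ Z := fun h => hxA (by simpa [Z, htx] using h)
  obtain ⟨a, ⟨haZ, ha0, hat⟩, ha⟩ :=
    ((isCompact_Icc (a := 0) (b := t)).inter_left hZ).exists_isGreatest
    ⟨0, by simpa [Z, hφ0] using hyA, by simp [ht0]⟩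
  obtain ⟨b, ⟨hbZ, hbt, hb1⟩, hb⟩ :=
    ((isCompact_Icc (a := t) (b := 2 * Real.pi)).inter_left hZ).exists_isLeast
    ⟨2 * Real.pi, by simpa [Z, hφ1] using hyA, by simp [ht1]⟩
  have hat' : a < t := lt_of_le_of_ne hat fun h => htZ (h ▸ haZ)
  have hbt' : t < b := lt_of_le_of_ne hbt fun h => htZ (h ▸ hbZ)
  have hab : a < b := hat'.trans hbt'
  have hIoo : Ioo a b ⊆ φ ⁻¹' B := by
    intro s hs
    refine (hC (hφC s)).resolve_left fun hsA => ?_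
    rcases le_total s t with h | h
    · exact hs.1.not_ge (ha ⟨hsA, ha0.trans hs.1.le, h⟩)
    · exact hs.2.not_ge (hb ⟨hsA, h, hs.2.le.trans hb1⟩)
  have hIcc : Icc a b ⊆ φ ⁻¹' B := by
    rw [← closure_Ioo hab.ne]
    exact (hB.preimage hφ).closure_subset_iff.2 hIoo
  have haB := hIcc (left_mem_Icc.2 hab.le)
  have hbB := hIcc (right_mem_Icc.2 hab.le)
  have ha0' : 0 < a := lt_of_le_of_ne ha0 fun h => hyB (by simpa [← h, hφ0] using haB)
  refine ⟨φ '' Icc a b, image_subset_iff.2 hIcc, isPreconnected_Icc.image _ hφ.continuousOn,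
    φ a, ⟨haZ, mem_image_of_mem _ (left_mem_Icc.2 hab.le)⟩,
    φ b, ⟨hbZ, mem_image_of_mem _ (right_mem_Icc.2 hab.le)⟩, fun h => ?_⟩
  obtain ⟨n, hn⟩ := Circle.exp_eq_exp.1 (hφinj _ _ h)
  have hn0 : -1 < (n : ℝ) := by nlinarith [Real.two_pi_pos]
  have hn1 : (n : ℝ) < 0 := by nlinarith [Real.two_pi_pos]
  have : -1 < n := by exact_mod_cast hn0
  have : n < 0 := by exact_mod_cast hn1
  omega

/-- The attractor of finitely many contractions is connected if its first-level pieces overlap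
according to the pattern of a finite closed cover of a connected set. -/
theorem isPreconnected_of_contractions {X ι : Type*} [MetricSpace X] [Finite ι]
    {S : ι → X → X} {R : ℝ} (hR0 : 0 ≤ R) (hR : R < 1)
    (hS : ∀ i x y, dist (S i x) (S i y) ≤ R * dist x y) {K : Set X} (hK : IsCompact K)
    (hKS : K = ⋃ i, S i '' K) {Q : ι → Set X} (hQ : ∀ i, IsClosed (Q i))
    (hQne : ∀ i, (Q i).Nonempty) (hQc : IsPreconnected (⋃ i, Q i))
    (hQK : ∀ i j, i ≠ j → (Q i ∩ Q j).Nonempty → (S i '' K ∩ S j '' K).Nonempty) :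
    IsPreconnected K := by
  rw [isPreconnected_iff_subset_of_fully_disjoint_closed hK.isClosed]
  intro A B hA hB hKAB hAB
  have step : ∀ g : X → X, (∀ i, g '' (S i '' K) ⊆ A ∨ g '' (S i '' K) ⊆ B) →
      g '' K ⊆ A ∨ g '' K ⊆ B := by
    intro g hg
    have hcl : ∀ p : ι → Prop, IsClosed (⋃ i, ⋃ _ : p i, Q i) := fun p =>
      isClosed_iUnion_of_finite fun i => isClosed_iUnion_of_finite fun _ => hQ i
    let U := ⋃ i, ⋃ _ : g '' (S i '' K) ⊆ A, Q i
    let W := ⋃ i, ⋃ _ : ¬ g '' (S i '' K) ⊆ A, Q i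
    have hdisj : Disjoint U W := by
      refine Set.disjoint_left.2 fun v hvU hvW => ?_
      simp only [U, W, mem_iUnion, exists_prop] at hvU hvW
      obtain ⟨⟨i, hi, hvi⟩, ⟨j, hj, hvj⟩⟩ := hvU, hvW
      obtain ⟨z, hzi, hzj⟩ := hQK i j (fun h => hj (h ▸ hi)) ⟨v, hvi, hvj⟩
      exact Set.disjoint_left.1 hAB (hi ⟨z, hzi, rfl⟩) ((hg j).resolve_left hj ⟨z, hzj, rfl⟩)
    have hcov : ⋃ i, Q i ⊆ U ∪ W := by
      refine iUnion_subset fun i v hv => ?_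
      by_cases hi : g '' (S i '' K) ⊆ A
      · exact .inl (mem_iUnion₂.2 ⟨i, hi, hv⟩)
      · exact .inr (mem_iUnion₂.2 ⟨i, hi, hv⟩)
    have himg : ∀ T : Set X, (∀ i, g '' (S i '' K) ⊆ T) → g '' K ⊆ T := by
      intro T hT
      rw [hKS, image_iUnion]
      exact iUnion_subset hT
    rcases isPreconnected_iff_subset_of_disjoint_closed.1 hQc U W (hcl _) (hcl _) hcov
      (by rw [hdisj.inter_eq, inter_empty]) with h | h
    · refine .inl (himg A fun i => ?_)
      by_contra hi
      obtain ⟨v, hv⟩ := hQne i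
      exact Set.disjoint_left.1 hdisj (h (mem_iUnion.2 ⟨i, hv⟩)) (mem_iUnion₂.2 ⟨i, hi, hv⟩)
    · refine .inr (himg B fun i => (hg i).resolve_left fun hi => ?_)
      obtain ⟨v, hv⟩ := hQne i
      exact Set.disjoint_left.1 hdisj (mem_iUnion₂.2 ⟨i, hi, hv⟩) (h (mem_iUnion.2 ⟨i, hv⟩))
  obtain ⟨δ, hδ, hball⟩ := lebesgue_number_lemma_of_metric (c := fun b : Bool => cond b Aᶜ Bᶜ) hK
    (by rintro (_ | _); exacts [hB.isOpen_compl, hA.isOpen_compl]) (by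
      intro x _
      by_cases hxA : x ∈ A
      · exact mem_iUnion.2 ⟨false, Set.disjoint_left.1 hAB hxA⟩
      · exact mem_iUnion.2 ⟨true, hxA⟩)
  have small : ∀ n : ℕ, ∀ (g : X → X) (L : ℝ), MapsTo g K K →
      (∀ x ∈ K, ∀ y ∈ K, dist (g x) (g y) ≤ L * dist x y) → 0 ≤ L →
      L * R ^ n * Metric.diam K < δ → g '' K ⊆ A ∨ g '' K ⊆ B := by
    intro n
    induction n with
    | zero =>
      intro g L hgK hgL hL hlt
      rcases K.eq_empty_or_nonempty with hKe | ⟨x, hx⟩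
      · simp [hKe]
      obtain ⟨b, hb⟩ := hball (g x) (hgK hx)
      have hsub : g '' K ⊆ Metric.ball (g x) δ := by
        rintro _ ⟨y, hy, rfl⟩
        rw [Metric.mem_ball]
        refine (hgL y hy x hx).trans_lt (lt_of_le_of_lt ?_ hlt)
        rw [pow_zero, mul_one]
        exact mul_le_mul_of_nonneg_left (Metric.dist_le_diam_of_mem hK.isBounded hy hx) hL
      have hsub' : g '' K ⊆ A ∪ B := (image_subset_iff.2 hgK).trans hKAB
      cases b with
      | false => exact .inl fun z hz => (hsub' hz).resolve_right (hb (hsub hz))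
      | true => exact .inr fun z hz => (hsub' hz).resolve_left (hb (hsub hz))
    | succ n ih =>
      intro g L hgK hgL hL hlt
      have hSK : ∀ i, MapsTo (S i) K K := fun i x hx => by
        rw [hKS]; exact mem_iUnion.2 ⟨i, x, hx, rfl⟩
      refine step g fun i => ?_
      rw [← image_comp]
      refine ih (g ∘ S i) (L * R) (hgK.comp (hSK i)) (fun x hx y hy => ?_) (mul_nonneg hL hR0) ?_
      · refine (hgL _ (hSK i hx) _ (hSK i hy)).trans ?_
        rw [mul_assoc]
        exact mul_le_mul_of_nonneg_left (hS i x y) hL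
      · rwa [mul_assoc L R, ← pow_succ']
  have hlim : Filter.Tendsto (fun n : ℕ => 1 * R ^ n * Metric.diam K) Filter.atTop (nhds 0) := by
    simpa using (tendsto_pow_atTop_nhds_zero_of_lt_one hR0 hR).mul_const (Metric.diam K)
  obtain ⟨n, hn⟩ := (hlim.eventually_lt_const hδ).exists
  simpa using small n id 1 (mapsTo_id K) (by simp) zero_le_one hn

/-- A set that is, at every scale, a finite union of small closed connected sets is locally
connected. -/
theorem locallyConnectedSpace_of_finite_small_covers {X : Type*} [MetricSpace X] {K : Set X}
    (h : ∀ ε > 0, ∃ 𝒜 : Set (Set X), 𝒜.Finite ∧ ⋃₀ 𝒜 = K ∧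
      ∀ A ∈ 𝒜, IsClosed A ∧ IsPreconnected A ∧ ∀ x ∈ A, ∀ y ∈ A, dist x y < ε) :
    LocallyConnectedSpace K := by
  rw [locallyConnectedSpace_iff_connected_subsets]
  intro x U hU
  obtain ⟨ε, hε, hεU⟩ := Metric.mem_nhds_iff.1 hU
  obtain ⟨𝒜, hfin, hcov, h𝒜⟩ := h ε hε
  have pre : ∀ A ∈ 𝒜, IsPreconnected (Subtype.val ⁻¹' A : Set K) := fun A hA => by
    rw [← Topology.IsInducing.subtypeVal.isPreconnected_image, Subtype.image_preimage_coe,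
      inter_eq_right.2 (hcov ▸ subset_sUnion_of_mem hA)]
    exact (h𝒜 A hA).2.1
  refine ⟨⋃ A ∈ {A ∈ 𝒜 | (x : X) ∈ A}, Subtype.val ⁻¹' A, ?_, ?_, ?_⟩
  · have hcl : IsClosed (⋃ A ∈ {A ∈ 𝒜 | (x : X) ∉ A}, (Subtype.val ⁻¹' A : Set K)) :=
      (hfin.subset (sep_subset _ _)).isClosed_biUnion fun A hA =>
        (h𝒜 A hA.1).1.preimage continuous_subtype_val
    refine Filter.mem_of_superset (hcl.isOpen_compl.mem_nhds ?_) ?_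
    · simp only [mem_compl_iff, mem_iUnion, not_exists]
      exact fun A hA hxA => hA.2 hxA
    · intro y hy
      obtain ⟨A, hA, hyA⟩ : (y : X) ∈ ⋃₀ 𝒜 := hcov ▸ y.2
      refine mem_iUnion₂.2 ⟨A, ⟨hA, ?_⟩, hyA⟩
      by_contra hxA
      exact hy (mem_iUnion₂.2 ⟨A, ⟨hA, hxA⟩, hyA⟩)
  · rw [← sUnion_image]
    refine isPreconnected_sUnion x _ ?_ ?_
    · rintro _ ⟨A, hA, rfl⟩
      exact hA.2
    · rintro _ ⟨A, hA, rfl⟩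
      exact pre A hA.1
  · refine iUnion₂_subset fun A hA y hy => hεU ?_
    exact (h𝒜 A hA.1).2.2 _ hy _ hA.2

/-- A connected attractor of finitely many contractions is locally connected. -/
theorem locallyConnectedSpace_of_contractions {X ι : Type*} [MetricSpace X] [Finite ι]
    {S : ι → X → X} {R : ℝ} (hR0 : 0 ≤ R) (hR : R < 1)
    (hS : ∀ i x y, dist (S i x) (S i y) ≤ R * dist x y) {K : Set X} (hK : IsCompact K)
    (hKS : K = ⋃ i, S i '' K) (hKc : IsPreconnected K) : LocallyConnectedSpace K := by
  have hScont : ∀ i, Continuous (S i) := fun i =>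
    (LipschitzWith.of_dist_le_mul (K := ⟨R, hR0⟩) (hS i)).continuous
  have cover : ∀ n : ℕ, ∃ 𝒜 : Set (Set X), 𝒜.Finite ∧ ⋃₀ 𝒜 = K ∧
      ∀ A ∈ 𝒜, IsCompact A ∧ IsPreconnected A ∧
        ∀ x ∈ A, ∀ y ∈ A, dist x y ≤ R ^ n * Metric.diam K := by
    intro n
    induction n with
    | zero =>
      refine ⟨{K}, finite_singleton K, sUnion_singleton K, ?_⟩
      rintro _ rfl
      refine ⟨hK, hKc, fun x hx y hy => ?_⟩
      simpa using Metric.dist_le_diam_of_mem hK.isBounded hx hy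
    | succ n ih =>
      obtain ⟨𝒜, hfin, hcov, h𝒜⟩ := ih
      refine ⟨⋃ i, (S i '' ·) '' 𝒜, finite_iUnion fun i => hfin.image _, ?_, ?_⟩
      · conv_rhs => rw [hKS, ← hcov]
        simp only [sUnion_iUnion, sUnion_image, image_sUnion]
      · intro A hA
        obtain ⟨i, A', hA', rfl⟩ := mem_iUnion.1 hA
        obtain ⟨hAk, hAc, hAd⟩ := h𝒜 A' hA'
        refine ⟨hAk.image (hScont i), hAc.image _ (hScont i).continuousOn, ?_⟩
        rintro _ ⟨x, hx, rfl⟩ _ ⟨y, hy, rfl⟩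
        rw [pow_succ', mul_assoc]
        exact (hS i x y).trans (mul_le_mul_of_nonneg_left (hAd x hx y hy) hR0)
  refine locallyConnectedSpace_of_finite_small_covers fun ε hε => ?_
  have hlim : Filter.Tendsto (fun n : ℕ => R ^ n * Metric.diam K) Filter.atTop (nhds 0) := by
    simpa using (tendsto_pow_atTop_nhds_zero_of_lt_one hR0 hR).mul_const (Metric.diam K)
  obtain ⟨n, hn⟩ := (hlim.eventually_lt_const hε).exists
  obtain ⟨𝒜, hfin, hcov, h𝒜⟩ := cover n
  exact ⟨𝒜, hfin, hcov, fun A hA => ⟨(h𝒜 A hA).1.isClosed, (h𝒜 A hA).2.1,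
    fun x hx y hy => ((h𝒜 A hA).2.2 x hx y hy).trans_lt hn⟩⟩

/-- A set homeomorphic to the circle is infinite. -/
theorem infinite_of_homeomorph_circle {X : Type*} [TopologicalSpace X] {C : Set X}
    (e : C ≃ₜ Circle) : C.Infinite := by
  have : Infinite (Ioc (-Real.pi) Real.pi) :=
    (Ioc_infinite (by linarith [Real.pi_pos])).to_subtype
  exact infinite_coe_iff.1 ((e.toEquiv.trans Circle.argEquiv).infinite_iff.2 this)

/-- If every circle in the attractor of contractive embeddings lies in a first-level piece, then
the attractor contains no circle. -/
theorem not_homeomorph_circle_of_contractions {X ι : Type*} [MetricSpace X]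
    {S : ι → X → X} {R : ℝ} (hR0 : 0 ≤ R) (hR : R < 1)
    (hS : ∀ i x y, dist (S i x) (S i y) ≤ R * dist x y) (hSe : ∀ i, Topology.IsEmbedding (S i))
    {K : Set X} (hK : IsCompact K)
    (hpiece : ∀ C ⊆ K, Nonempty (C ≃ₜ Circle) → ∃ i, C ⊆ S i '' K) :
    ∀ C ⊆ K, ¬ Nonempty (C ≃ₜ Circle) := by
  have small : ∀ n : ℕ, ∀ C ⊆ K, Nonempty (C ≃ₜ Circle) →
      ∀ x ∈ C, ∀ y ∈ C, dist x y ≤ R ^ n * Metric.diam K := by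
    intro n
    induction n with
    | zero =>
      intro C hC _ x hx y hy
      simpa using Metric.dist_le_diam_of_mem hK.isBounded (hC hx) (hC hy)
    | succ n ih =>
      rintro C hC ⟨e⟩ x hx y hy
      obtain ⟨i, hi⟩ := hpiece C hC ⟨e⟩
      obtain ⟨C, hCK, rfl⟩ := subset_image_iff.1 hi
      obtain ⟨x, hx, rfl⟩ := hx
      obtain ⟨y, hy, rfl⟩ := hy
      rw [pow_succ', mul_assoc]
      exact (hS i x y).trans (mul_le_mul_of_nonneg_left
        (ih C hCK ⟨((hSe i).homeomorphImage C).trans e⟩ x hx y hy) hR0)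
  rintro C hC ⟨e⟩
  obtain ⟨x, hx, y, hy, hxy⟩ := (infinite_of_homeomorph_circle e).nontrivial
  have hlim : Filter.Tendsto (fun n : ℕ => R ^ n * Metric.diam K) Filter.atTop (nhds 0) := by
    simpa using (tendsto_pow_atTop_nhds_zero_of_lt_one hR0 hR).mul_const (Metric.diam K)
  obtain ⟨n, hn⟩ := (hlim.eventually_lt_const (dist_pos.2 hxy)).exists
  exact (small n C hC ⟨e⟩ x hx y hy).not_gt hn

/-- In a contractible finite union of closed connected sets meeting pairwise in finite sets, every
circle lies in one of the sets. -/
theorem circle_subset_of_contractible_iUnion {X ι : Type*} [MetricSpace X] [Finite ι]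
    {Q : ι → Set X} (hQ : ∀ i, IsClosed (Q i)) (hQc : ∀ i, IsPreconnected (Q i))
    (hQQ : ∀ i j, i ≠ j → (Q i ∩ Q j).Finite) (hc : ContractibleSpace ↥(⋃ i, Q i))
    {C : Set X} (hC : C ⊆ ⋃ i, Q i) (e : C ≃ₜ Circle) : ∃ i, C ⊆ Q i := by
  have hfin : (⋃ i, ⋃ j, ⋃ _ : i ≠ j, Q i ∩ Q j).Finite :=
    finite_iUnion fun i => finite_iUnion fun j => finite_iUnion fun h => hQQ i j h
  obtain ⟨y, hyC, hy⟩ := (infinite_of_homeomorph_circle e).exists_notMem_finite hfin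
  simp only [mem_iUnion, not_exists] at hy
  obtain ⟨i, hyi⟩ := mem_iUnion.1 (hC hyC)
  refine ⟨i, fun x hxC => ?_⟩
  by_contra hxi
  let B := ⋃ j, ⋃ _ : i ≠ j, Q j
  have hB : IsClosed B :=
    isClosed_iUnion_of_finite fun j => isClosed_iUnion_of_finite fun _ => hQ j
  have hyB : y ∉ B := by
    simp only [B, mem_iUnion, not_exists]
    exact fun j hij hyj => hy i j hij ⟨hyi, hyj⟩
  have hunion : ⋃ i, Q i = Q i ∪ B := by
    ext z
    simp only [B, mem_union, mem_iUnion, exists_prop]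
    refine ⟨fun ⟨j, hj⟩ => ?_, ?_⟩
    · by_cases hij : i = j
      · exact .inl (hij ▸ hj)
      · exact .inr ⟨j, hij, hj⟩
    · rintro (h | ⟨j, -, h⟩)
      exacts [⟨i, h⟩, ⟨j, h⟩]
  rw [hunion] at hc hC
  obtain ⟨D, hDB, hD, p, hp, q, hq, hpq⟩ :=
    exists_preconnected_subset_of_circle (hQ i) hB hC e hxC hxi hyC hyB
  refine hpq (eq_of_mem_inter_of_contractible_union (hQ i) hB hc (hQc i) ?_ hDB hD hp hq)
  simp only [B, inter_iUnion]
  exact finite_iUnion fun j => finite_iUnion fun h => hQQ i j h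

/-- The attractor of a contractible `P`-polyhedral system is a dendrite: a (compact)
connected, locally connected set containing no simple closed curve. -/
theorem stmt_13 {d m : ℕ} (P : Set (EuclideanSpace ℝ (Fin d)))
    (V : Finset (EuclideanSpace ℝ (Fin d)))
    (S : Fin m → EuclideanSpace ℝ (Fin d) → EuclideanSpace ℝ (Fin d))
    (hP : IsPolyhedronWithVertices P V)
    (hS : IsPPolyhedralSystem P V S)
    (hcontr : ContractibleSpace ↥(⋃ i, S i '' P))
    (K : Set (EuclideanSpace ℝ (Fin d))) (hKne : K.Nonempty) (hKc : IsCompact K)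
    (hKinv : K = ⋃ i, S i '' K) :
    IsConnected K ∧ LocallyConnectedSpace K ∧
      ∀ C ⊆ K, ¬ Nonempty (C ≃ₜ Circle) := by
  obtain ⟨hPc, hVP, ⟨eP⟩⟩ := hP
  obtain ⟨hsim, hSP, hSint, hVS⟩ := hS
  choose r hr hdist using hsim
  obtain ⟨i₀, -⟩ := mem_iUnion.1 (hKinv.subset hKne.some_mem)
  have : Nonempty (Fin m) := ⟨i₀⟩
  obtain ⟨k, hk⟩ := Finite.exists_max r
  have hR0 : 0 ≤ r k := (hr k).1.le
  have hR1 : r k < 1 := (hr k).2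
  have hSR : ∀ i x y, dist (S i x) (S i y) ≤ r k * dist x y := fun i x y =>
    (hdist i x y).trans_le (mul_le_mul_of_nonneg_right (hk i) dist_nonneg)
  have hScont : ∀ i, Continuous (S i) := fun i =>
    (LipschitzWith.of_dist_le_mul (K := ⟨r k, hR0⟩) (hSR i)).continuous
  have hSe : ∀ i, Topology.IsEmbedding (S i) := fun i =>
    ((AntilipschitzWith.of_le_mul_dist (K := ⟨(r i)⁻¹, (inv_pos.2 (hr i).1).le⟩) fun x y => by
      rw [hdist i x y]
      exact (inv_mul_cancel_left₀ (hr i).1.ne' _).ge).isUniformEmbedding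
      (LipschitzWith.of_dist_le_mul (K := ⟨r k, hR0⟩) (hSR i)).uniformContinuous).isEmbedding
  have hball : IsConnected (Metric.closedBall (0 : EuclideanSpace ℝ (Fin d)) 1) :=
    ⟨Metric.nonempty_closedBall.2 zero_le_one,
      (convex_closedBall (0 : EuclideanSpace ℝ (Fin d)) 1).isPreconnected⟩
  have hPconn : IsConnected P := by
    rw [isConnected_iff_connectedSpace] at hball ⊢
    exact eP.symm.surjective.connectedSpace eP.symm.continuous
  have hKS : ∀ i, S i '' K ⊆ K := fun i => by
    conv_rhs => rw [hKinv]
    exact subset_iUnion (fun i => S i '' K) i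
  have hKP : K ⊆ P := subset_of_subset_iUnion_image_of_contraction hR1 hSR hKc hKinv.subset hPc
    hPconn.nonempty hSP
  have hVK : (V : Set (EuclideanSpace ℝ (Fin d))) ⊆ K :=
    subset_of_subset_iUnion_image_of_contraction hR1 hSR V.finite_toSet.isCompact hVS hKc hKne hKS
  have hQ : ∀ i, IsClosed (S i '' P) := fun i => (hPc.image (hScont i)).isClosed
  have hpre : IsPreconnected K := by
    refine isPreconnected_of_contractions hR0 hR1 hSR hKc hKinv hQ
      (fun i => hPconn.nonempty.image _) ?_ ?_
    · exact isPreconnected_iff_preconnectedSpace.2 inferInstance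
    · intro i j hij hne
      rcases hSint i j hij with h | ⟨v, -, hvi, hvj⟩
      · exact absurd h hne.ne_empty
      · exact ⟨v, image_mono hVK hvi, image_mono hVK hvj⟩
  refine ⟨⟨hKne, hpre⟩, locallyConnectedSpace_of_contractions hR0 hR1 hSR hKc hKinv hpre,
    not_homeomorph_circle_of_contractions hR0 hR1 hSR hSe hKc ?_⟩
  rintro C hCK ⟨e⟩
  have hKQ : K ⊆ ⋃ i, S i '' P := hKinv.subset.trans (iUnion_mono fun i => image_mono hKP)
  obtain ⟨i, hi⟩ := circle_subset_of_contractible_iUnion hQ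
    (fun i => hPconn.isPreconnected.image _ (hScont i).continuousOn)
    (fun i j hij => by
      rcases hSint i j hij with h | ⟨v, h, -⟩ <;> simp [h])
    hcontr (hCK.trans hKQ) e
  refine ⟨i, fun x hx => ?_⟩
  obtain ⟨j, hj⟩ := mem_iUnion.1 (hKinv.subset (hCK hx))
  by_cases hij : i = j
  · exact hij ▸ hj
  have hxij : x ∈ S i '' P ∩ S j '' P := ⟨hi hx, image_mono hKP hj⟩
  rcases hSint i j hij with h | ⟨v, h, hvi, -⟩
  · exact absurd hxij (h ▸ notMem_empty x)
  · rw [h, mem_singleton_iff] at hxij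
    exact image_mono hVK (hxij ▸ hvi)
end

section
/- Let K be a dendrite, V a finite subset of K, and γ̂ the union of all arcs joining pairs of points of V. A point x ∈ K is a cut point of γ̂ (i.e. x ∈ γ̂ and γ̂ \ {x} is disconnected) if and only if there exist A, B ∈ V belonging to different connected components of K \ {x}. -/
/-- `A` is an arc from `a` to `b`: a homeomorphic image of `[0,1]` with endpoints `a`
and `b`. -/
def IsArcBetween {X : Type*} [TopologicalSpace X] (A : Set X) (a b : X) : Prop :=
  ∃ f : Set.Icc (0 : ℝ) 1 → X, Continuous f ∧ Function.Injective f ∧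
    Set.range f = A ∧ f ⟨0, by norm_num⟩ = a ∧ f ⟨1, by norm_num⟩ = b

open Set Filter Topology

/-- Points of a preconnected set are joined by chains with arbitrarily small jumps. -/
theorem IsPreconnected.exists_chain {X : Type*} [PseudoMetricSpace X] {S : Set X}
    (hS : IsPreconnected S) {y z : X} (hy : y ∈ S) (hz : z ∈ S) {δ : ℝ} (hδ : 0 < δ) :
    ∃ (m : ℕ) (c : ℕ → X), c 0 = y ∧ (∀ j ≥ m, c j = z) ∧ (∀ j, c j ∈ S) ∧
      ∀ j, dist (c j) (c (j + 1)) < δ := by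
  have key : Relation.ReflTransGen (fun a b => a ∈ S ∧ b ∈ S ∧ dist a b < δ) y z := by
    refine hS.induction₂ _ (fun a ha => ?_) (fun _ _ _ _ _ _ => Relation.ReflTransGen.trans)
      (fun a b _ _ hab => ?_) hy hz
    · filter_upwards [self_mem_nhdsWithin, mem_nhdsWithin_of_mem_nhds (Metric.ball_mem_nhds a hδ)]
        with b hb hab
      exact .single ⟨ha, hb, by rwa [dist_comm]⟩
    · have : Std.Symm (fun a b => a ∈ S ∧ b ∈ S ∧ dist a b < δ) :=
        ⟨fun a b ⟨ha, hb, hab⟩ => ⟨hb, ha, by rwa [dist_comm]⟩⟩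
      exact Relation.ReflTransGen.stdSymm.symm _ _ hab
  induction key using Relation.ReflTransGen.head_induction_on with
  | refl => exact ⟨0, fun _ => z, rfl, fun _ _ => rfl, fun _ => hz, fun _ => by simpa⟩
  | @head a b hab _ ih =>
    obtain ⟨m, c, h0, hm, hc, hd⟩ := ih hab.2.1
    refine ⟨m + 1, fun j => Nat.casesOn j a c, rfl, fun j hj => ?_, fun j => ?_, fun j => ?_⟩
    · obtain ⟨j, rfl⟩ : ∃ i, j = i + 1 := ⟨j - 1, by omega⟩
      exact hm j (by omega)
    · cases j
      exacts [hab.1, hc _]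
    · cases j
      · simpa [h0] using hab.2.2
      · exact hd _

/-- A `δ`-chain can be refined to a finer chain which stays `ε`-close to it. -/
theorem exists_chain_refinement {X : Type*} [PseudoMetricSpace X] {δ ε δ' : ℝ} (hε : 0 < ε)
    (hδ' : 0 < δ')
    (hδ : ∀ y z : X, dist y z < δ →
      ∃ S, IsPreconnected S ∧ y ∈ S ∧ z ∈ S ∧ S ⊆ Metric.ball y ε)
    {k : ℕ} {c : ℕ → X} {z : X} (hk : ∀ j ≥ k, c j = z) (hc : ∀ j, dist (c j) (c (j + 1)) < δ) :
    ∃ (m : ℕ) (c' : ℕ → X), 0 < m ∧ c' 0 = c 0 ∧ (∀ j ≥ k * m, c' j = z) ∧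
      (∀ j, dist (c' j) (c' (j + 1)) < δ') ∧ ∀ j, dist (c (j / m)) (c' j) ≤ ε := by
  have h : ∀ i, ∃ (M : ℕ) (ch : ℕ → X), (c i = c (i + 1) → M = 0) ∧ ch 0 = c i ∧
      (∀ j ≥ M, ch j = c (i + 1)) ∧ (∀ j, dist (c i) (ch j) ≤ ε) ∧
      ∀ j, dist (ch j) (ch (j + 1)) < δ' := by
    intro i
    by_cases hi : c i = c (i + 1)
    · exact ⟨0, fun _ => c i, fun _ => rfl, rfl, fun _ _ => hi, fun _ => by simpa using hε.le,
        fun _ => by simpa⟩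
    · obtain ⟨S, hS, h1, h2, h3⟩ := hδ _ _ (hc i)
      obtain ⟨M, ch, h4, h5, h6, h7⟩ := hS.exists_chain h1 h2 hδ'
      exact ⟨M, ch, fun h => (hi h).elim, h4, h5,
        fun j => by rw [dist_comm]; exact (h3 (h6 j)).le, h7⟩
  choose M ch hM h0 hend hball hstep using h
  set m := 1 + ∑ i ∈ Finset.range k, M i with hm
  have hMm : ∀ i, M i ≤ m := by
    intro i
    by_cases hi : i < k
    · have := Finset.single_le_sum (f := M) (fun _ _ => Nat.zero_le _) (Finset.mem_range.2 hi)
      omega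
    · rw [hM i (by rw [hk _ (by omega), hk _ (by omega)])]
      omega
  have hm0 : 0 < m := by omega
  refine ⟨m, fun j => ch (j / m) (j % m), hm0, by simp [h0], fun j hj => ?_, fun j => ?_,
    fun j => hball _ _⟩
  · have hj' : k ≤ j / m := (Nat.le_div_iff_mul_le hm0).2 hj
    have := hM (j / m) (by rw [hk _ hj', hk _ (by omega)])
    change ch (j / m) (j % m) = z
    rw [hend _ _ (by omega), hk _ (by omega)]
  · have hlt := Nat.mod_lt j hm0
    change dist (ch (j / m) (j % m)) (ch ((j + 1) / m) ((j + 1) % m)) < δ'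
    have hj := Nat.div_add_mod j m
    by_cases hjm : j % m + 1 = m
    · have e1 : j + 1 = m * (j / m + 1) := by rw [mul_add]; omega
      rw [e1, Nat.mul_div_cancel_left _ hm0, Nat.mul_mod_right, h0,
        ← hend _ (j % m + 1) (by rw [hjm]; exact hMm _)]
      exact hstep _ _
    · have e1 : j + 1 = j % m + 1 + m * (j / m) := by omega
      have h2 : (j + 1) / m = j / m := by
        conv_lhs => rw [e1]
        rw [Nat.add_mul_div_left _ _ hm0, Nat.div_eq_of_lt (by omega), zero_add]
      have h3 : (j + 1) % m = j % m + 1 := by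
        conv_lhs => rw [e1]
        rw [Nat.add_mul_mod_self_left, Nat.mod_eq_of_lt (by omega)]
      rw [h2, h3]
      exact hstep _ _

/-- A compact locally connected metric space is uniformly locally connected. -/
theorem uniform_locally_connected {X : Type*} [PseudoMetricSpace X] [CompactSpace X]
    [LocallyConnectedSpace X] {ε : ℝ} (hε : 0 < ε) :
    ∃ δ > 0, ∀ y z : X, dist y z < δ →
      ∃ S, IsPreconnected S ∧ y ∈ S ∧ z ∈ S ∧ S ⊆ Metric.ball y ε := by
  obtain ⟨δ, hδ, h⟩ := lebesgue_number_lemma_of_metric (s := (univ : Set X)) isCompact_univ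
    (c := fun w : X => connectedComponentIn (Metric.ball w (ε / 2)) w)
    (fun w => Metric.isOpen_ball.connectedComponentIn)
    (fun w _ => mem_iUnion.2 ⟨w, mem_connectedComponentIn (Metric.mem_ball_self (by linarith))⟩)
  refine ⟨δ, hδ, fun y z hyz => ?_⟩
  obtain ⟨w, hw⟩ := h y trivial
  have hy := hw (Metric.mem_ball_self hδ)
  refine ⟨_, isPreconnected_connectedComponentIn, hy, hw (by rwa [Metric.mem_ball, dist_comm]),
    fun v hv => ?_⟩
  have h1 := connectedComponentIn_subset _ _ hv
  have h2 := connectedComponentIn_subset _ _ hy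
  rw [Metric.mem_ball] at *
  linarith [dist_triangle_right v y w]

/-- In a compact locally connected metric space, close points are joined by small paths. -/
theorem exists_small_path {X : Type*} [MetricSpace X] [CompactSpace X]
    [LocallyConnectedSpace X] {C : ℝ} (hC : 0 < C) :
    ∃ δ > 0, ∀ y z : X, dist y z < δ →
      ∃ f : ℝ → X, Continuous f ∧ f 0 = y ∧ f 1 = z ∧ ∀ t, dist y (f t) ≤ 2 * C := by
  have hεpos : ∀ n : ℕ, 0 < C / 2 / 2 ^ n := fun n => by positivity
  choose δ hδ hconn using fun n => uniform_locally_connected (X := X) (hεpos n)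
  refine ⟨min (δ 0) C, lt_min (hδ 0) hC, fun y z hyz => ?_⟩
  obtain ⟨hyz0, hyzC⟩ := lt_min_iff.1 hyz
  -- level `n` approximations: chains with jumps smaller than `δ n`
  let η : ℕ → ℝ := fun n => min (δ n) (C / 2 ^ n)
  have hη : ∀ n, 0 < η n := fun n => lt_min (hδ n) (by positivity)
  let St : ℕ → Type _ := fun n => {s : ℕ × (ℕ → X) // 0 < s.1 ∧ s.2 0 = y ∧
    (∀ j ≥ s.1, s.2 j = z) ∧ ∀ j, dist (s.2 j) (s.2 (j + 1)) < η n}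
  have step : ∀ n (s : St n), ∃ s' : St (n + 1), ∃ m : ℕ, 0 < m ∧ s'.1.1 = s.1.1 * m ∧
      ∀ j, dist (s.1.2 (j / m)) (s'.1.2 j) ≤ C / 2 / 2 ^ n := by
    rintro n ⟨⟨k, c⟩, hk, h0, hz, hd⟩
    obtain ⟨m, c', hm, h0', hz', hd', hb⟩ := exists_chain_refinement (hεpos n) (hη (n + 1))
      (hconn n) hz (fun j => (hd j).trans_le (min_le_left _ _))
    exact ⟨⟨⟨k * m, c'⟩, Nat.mul_pos hk hm, h0'.trans h0, hz', hd'⟩, m, hm, rfl, hb⟩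
  choose nxt m hm hkm hclose using step
  let s0 : St 0 := ⟨⟨1, fun j => if j = 0 then y else z⟩, one_pos, rfl,
    fun j hj => by simp [show j ≠ 0 by omega], fun j => by
      by_cases hj : j = 0
      · simp [hj, η, hyz0, hyzC]
      · simpa [hj] using hη 0⟩
  let s : ∀ n, St n := fun n => Nat.rec s0 (fun n s => nxt n s) n
  let F : ℝ → ℕ → X := fun t n => (s n).1.2 ⌊(s n).1.1 * t⌋₊
  have hF : ∀ t n, dist (F t n) (F t (n + 1)) ≤ C / 2 / 2 ^ n := by
    intro t n
    have hmn : (m n (s n) : ℝ) ≠ 0 := by exact_mod_cast (hm n (s n)).ne'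
    have e : ⌊((s n).1.1 : ℝ) * t⌋₊ = ⌊((s (n + 1)).1.1 : ℝ) * t⌋₊ / m n (s n) := by
      rw [← Nat.floor_div_natCast]
      congr 1
      change _ = ((nxt n (s n)).1.1 : ℝ) * t / _
      rw [hkm]
      push_cast
      field_simp
    change dist ((s n).1.2 _) _ ≤ _
    rw [e]
    exact hclose n (s n) _
  choose f hf using fun t => cauchySeq_tendsto_of_complete (cauchySeq_of_le_geometric_two (hF t))
  have hfd : ∀ t n, dist (F t n) (f t) ≤ C / 2 ^ n :=
    fun t n => dist_le_of_le_geometric_two_of_tendsto (hF t) (hf t) n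
  have hjump : ∀ n (u t : ℝ), u ≤ t → t - u < 1 / (s n).1.1 → dist (F u n) (F t n) ≤ C / 2 ^ n := by
    intro n u t hut htu
    have hk : (0 : ℝ) < (s n).1.1 := by exact_mod_cast (s n).2.1
    rw [lt_div_iff₀ hk] at htu
    have h1 : ⌊(s n).1.1 * u⌋₊ ≤ ⌊(s n).1.1 * t⌋₊ := Nat.floor_le_floor (by gcongr)
    have h2 : ⌊(s n).1.1 * t⌋₊ < ⌊(s n).1.1 * u⌋₊ + 2 := by
      rw [Nat.floor_lt' (by omega)]
      have := Nat.lt_floor_add_one ((s n).1.1 * u)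
      push_cast
      nlinarith
    change dist ((s n).1.2 _) ((s n).1.2 _) ≤ _
    obtain h | h : ⌊(s n).1.1 * t⌋₊ = ⌊(s n).1.1 * u⌋₊ ∨
      ⌊(s n).1.1 * t⌋₊ = ⌊(s n).1.1 * u⌋₊ + 1 := by omega
    · rw [h, dist_self]; positivity
    · rw [h]
      exact ((s n).2.2.2.2 _).le.trans (min_le_right _ _)
  have hmod : ∀ n (u t : ℝ), u ≤ t → t - u < 1 / (s n).1.1 → dist (f u) (f t) ≤ 3 * (C / 2 ^ n) := by
    intro n u t hut htu
    have := dist_triangle4 (f u) (F u n) (F t n) (f t)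
    have := hjump n u t hut htu
    have h1 := hfd u n
    rw [dist_comm] at h1
    linarith [hfd t n]
  have hcont : Continuous f := by
    rw [Metric.continuous_iff]
    intro t ε hε
    have hlim : Tendsto (fun n : ℕ => 3 * (C / 2 ^ n)) atTop (𝓝 0) := by
      have := (tendsto_pow_atTop_nhds_zero_of_lt_one (r := (1 / 2 : ℝ)) (by norm_num)
        (by norm_num)).const_mul (3 * C)
      simp only [mul_zero] at this
      refine this.congr fun n => ?_
      rw [one_div, inv_pow]; ring
    obtain ⟨n, hn⟩ := (hlim.eventually (gt_mem_nhds hε)).exists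
    have hk : (0 : ℝ) < (s n).1.1 := by exact_mod_cast (s n).2.1
    refine ⟨1 / (s n).1.1, by positivity, fun u hu => ?_⟩
    rw [Real.dist_eq, abs_lt] at hu
    rcases le_total u t with h | h
    · exact (hmod n u t h (by linarith)).trans_lt hn
    · rw [dist_comm]
      exact (hmod n t u h (by linarith)).trans_lt hn
  refine ⟨f, hcont, ?_, ?_, fun t => ?_⟩
  · refine tendsto_nhds_unique (hf 0) (tendsto_const_nhds.congr fun n => ?_)
    simp [F, (s n).2.2.1]
  · refine tendsto_nhds_unique (hf 1) (tendsto_const_nhds.congr fun n => ?_)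
    simp [F, (s n).2.2.2.1 _ le_rfl]
  · have h1 := hfd t 0
    have h2 : dist y (F t 0) ≤ C := by
      change dist y (if _ = 0 then y else z) ≤ C
      split_ifs
      · simpa using hC.le
      · exact hyzC.le
    have := dist_triangle y (F t 0) (f t)
    simp only [pow_zero, div_one] at h1
    linarith

theorem locallyPathConnectedSpace_of_compact_of_locallyConnected {X : Type*} [MetricSpace X]
    [CompactSpace X] [LocallyConnectedSpace X] : LocallyPathConnectedSpace X := by
  refine ⟨fun y => ⟨fun W => ⟨fun hW => ?_, fun ⟨V, hV, hVW⟩ => mem_of_superset hV.1 hVW⟩⟩⟩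
  obtain ⟨ε, hε, hεW⟩ := Metric.mem_nhds_iff.1 hW
  obtain ⟨δ, hδ, h⟩ := exists_small_path (X := X) (C := ε / 3) (by positivity)
  refine ⟨pathComponentIn W y, ⟨?_, isPathConnected_pathComponentIn (mem_of_mem_nhds hW)⟩,
    pathComponentIn_subset⟩
  refine mem_of_superset (Metric.ball_mem_nhds y hδ) fun z hz => ?_
  obtain ⟨f, hf, h0, h1, hb⟩ := h y z (by rwa [dist_comm])
  refine ⟨⟨⟨fun t => f t, by fun_prop⟩, by simpa, by simpa⟩, fun t => hεW ?_⟩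
  have := hb t
  rw [Metric.mem_ball, dist_comm]
  change dist y (f t) < ε
  linarith

/-- The distance from `y` to the part of the path `q` traversed up to time `s`. -/
noncomputable def pathDist {X : Type*} [MetricSpace X] (q : unitInterval → X) (y : X)
    (s : unitInterval) : ℝ :=
  sInf ((fun r => dist y (q (min r s))) '' univ)

section pathDist

variable {X : Type*} [MetricSpace X] {q : unitInterval → X}

theorem continuous_pathDist (hq : Continuous q) (y : X) : Continuous (pathDist q y) :=
  isCompact_univ.continuous_sInf (f := fun s r => dist y (q (min r s))) (by fun_prop)

theorem exists_pathDist_eq (hq : Continuous q) (y : X) (s : unitInterval) :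
    ∃ r ≤ s, pathDist q y s = dist y (q r) := by
  obtain ⟨r, -, hr⟩ := isCompact_univ.exists_sInf_image_eq (univ_nonempty (α := unitInterval))
    (f := fun r => dist y (q (min r s))) (by fun_prop)
  exact ⟨min r s, min_le_right _ _, hr⟩

theorem pathDist_le (y : X) {r s : unitInterval} (h : r ≤ s) :
    pathDist q y s ≤ dist y (q r) :=
  csInf_le ⟨0, by rintro _ ⟨_, -, rfl⟩; exact dist_nonneg⟩ ⟨r, trivial, by simp [h]⟩

theorem pathDist_antitone (hq : Continuous q) (y : X) : Antitone (pathDist q y) := by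
  intro s t hst
  obtain ⟨r, hr, h⟩ := exists_pathDist_eq hq y s
  exact h ▸ pathDist_le y (hr.trans hst)

theorem pathDist_nonneg (hq : Continuous q) (y : X) (s : unitInterval) :
    0 ≤ pathDist q y s := by
  obtain ⟨r, hr, h⟩ := exists_pathDist_eq hq y s
  exact h ▸ dist_nonneg

end pathDist

/-- A path whose fibres are intervals can be reparametrised to an injective path. -/
theorem exists_injective_reparametrization {X : Type*} [MetricSpace X] [CompactSpace X]
    {q : unitInterval → X} (hq : Continuous q)
    (hmono : ∀ s r t, s ≤ r → r ≤ t → q s = q t → q r = q s) (hne : q 0 ≠ q 1) :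
    ∃ f : unitInterval → X, Continuous f ∧ Function.Injective f ∧ range f = range q ∧
      f 0 = q 0 ∧ f 1 = q 1 := by
  have : Nonempty X := ⟨q 0⟩
  let y := TopologicalSpace.denseSeq X
  have hy : DenseRange y := TopologicalSpace.denseRange_denseSeq X
  obtain ⟨D, hD⟩ : ∃ D : ℝ, ∀ a b : X, dist a b ≤ D :=
    ⟨Metric.diam (univ : Set X), fun a b =>
      Metric.dist_le_diam_of_mem isCompact_univ.isBounded trivial trivial⟩
  let T : ℕ → unitInterval → ℝ := fun n s => (1 / 2) ^ n * pathDist q (y n) s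
  have hTle : ∀ n s, ‖T n s‖ ≤ (1 / 2) ^ n * D := by
    intro n s
    obtain ⟨r, hr, h⟩ := exists_pathDist_eq hq (y n) s
    rw [Real.norm_of_nonneg (mul_nonneg (by positivity) (pathDist_nonneg hq _ _))]
    exact mul_le_mul_of_nonneg_left (h ▸ hD _ _) (by positivity)
  have hsum : Summable fun n : ℕ => ((1 : ℝ) / 2) ^ n * D := summable_geometric_two.mul_right D
  have hTs : ∀ s, Summable fun n => T n s := fun s => .of_norm_bounded hsum fun n => hTle n s
  let G : unitInterval → ℝ := fun s => - ∑' n, T n s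
  have hG : Continuous G :=
    (continuous_tsum (fun n => (continuous_pathDist hq (y n)).const_mul _) hsum hTle).neg
  have hGmono : Monotone G := fun s t hst => neg_le_neg <|
    (hTs t).tsum_le_tsum
      (fun n => mul_le_mul_of_nonneg_left (pathDist_antitone hq _ hst) (by positivity)) (hTs s)
  have hGlt : ∀ s t, s ≤ t → q s ≠ q t → G s < G t := by
    intro s t hst hqst
    obtain ⟨r, hr, h⟩ := exists_pathDist_eq hq (q t) s
    have hpos : 0 < dist (q t) (q r) := by
      refine dist_pos.2 fun h => hqst ?_
      rw [hmono r s t hr hst h.symm, h]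
    obtain ⟨n, hn⟩ := hy.exists_dist_lt (q t) (half_pos hpos)
    refine neg_lt_neg ((hTs t).tsum_lt_tsum (i := n)
      (fun n => mul_le_mul_of_nonneg_left (pathDist_antitone hq _ hst) (by positivity)) ?_ (hTs s))
    refine mul_lt_mul_of_pos_left ?_ (by positivity)
    obtain ⟨r', hr', h'⟩ := exists_pathDist_eq hq (y n) s
    have h1 := pathDist_le (q := q) (y n) (le_refl t)
    have h2 := pathDist_le (q := q) (q t) hr'
    have h3 := dist_triangle (q t) (y n) (q r')
    rw [dist_comm] at h1
    rw [h']
    linarith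
  have hGeq : ∀ s t, s ≤ t → q s = q t → G s = G t := by
    intro s t hst hqst
    refine le_antisymm (hGmono hst) (neg_le_neg <| (hTs s).tsum_le_tsum
      (fun n => mul_le_mul_of_nonneg_left ?_ (by positivity)) (hTs t))
    obtain ⟨r, hr, h⟩ := exists_pathDist_eq hq (y n) t
    rw [h]
    rcases le_total r s with hrs | hrs
    · exact pathDist_le _ hrs
    · rw [hmono s r t hrs hr hqst]
      exact pathDist_le _ le_rfl
  have hiff : ∀ s t, G s = G t ↔ q s = q t := by
    intro s t
    rcases le_total s t with h | h
    · exact ⟨fun e => by_contra fun hn => (hGlt s t h hn).ne e, hGeq s t h⟩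
    · exact ⟨fun e => by_contra fun hn => (hGlt t s h (Ne.symm hn)).ne e.symm,
        fun e => (hGeq t s h e.symm).symm⟩
  have hG01 : 0 < G 1 - G 0 := sub_pos.2 (hGlt 0 1 zero_le_one hne)
  let H : unitInterval → unitInterval := fun s => ⟨(G s - G 0) / (G 1 - G 0),
    div_nonneg (sub_nonneg.2 (hGmono unitInterval.nonneg')) hG01.le,
    (div_le_one hG01).2 (sub_le_sub_right (hGmono unitInterval.le_one') _)⟩
  have hH : Continuous H := ((hG.sub continuous_const).div_const _).subtype_mk _
  have hHiff : ∀ s t, H s = H t ↔ q s = q t := by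
    intro s t
    rw [← hiff, Subtype.ext_iff]
    change (G s - G 0) / (G 1 - G 0) = (G t - G 0) / (G 1 - G 0) ↔ _
    rw [div_left_inj' hG01.ne', sub_left_inj]
  have hH0 : H 0 = 0 := Subtype.ext (by simp [H])
  have hH1 : H 1 = 1 := Subtype.ext (by simp [H, div_self hG01.ne'])
  have hsurj : Function.Surjective H := fun u =>
    mem_range_of_exists_le_of_exists_ge hH ⟨0, hH0.trans_le unitInterval.nonneg'⟩
      ⟨1, unitInterval.le_one'.trans_eq hH1.symm⟩
  have hquot : IsQuotientMap H := hH.isClosedMap.isQuotientMap hH hsurj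
  choose σ hσ using hsurj
  have hfH : ∀ s, q (σ (H s)) = q s := fun s => (hHiff _ _).1 (hσ _)
  refine ⟨q ∘ σ, ?_, fun u v huv => ?_, ?_, ?_, ?_⟩
  · rw [hquot.continuous_iff, show (q ∘ σ) ∘ H = q from funext hfH]
    exact hq
  · rw [← hσ u, ← hσ v, hHiff]
    exact huv
  · exact (range_comp_subset_range _ _).antisymm fun _ ⟨s, hs⟩ => ⟨H s, (hfH s).trans hs⟩
  · rw [← hfH 0, hH0]; rfl
  · rw [← hfH 1, hH1]; rfl

/-- A closed set of times whose complementary gaps are loops of `p`. -/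
structure IsLoopErasure {X : Type*} (p : ℝ → X) (C : Set ℝ) : Prop where
  isClosed : IsClosed C
  subset : C ⊆ Icc 0 1
  zero_mem : (0 : ℝ) ∈ C
  one_mem : (1 : ℝ) ∈ C
  gap : ∀ s ∈ C, ∀ t ∈ C, s < t → Disjoint (Ioo s t) C → p s = p t

/-- Any two points around a gap can be moved to the ends of that gap. -/
theorem IsLoopErasure.exists_gap {X : Type*} {p : ℝ → X} {C : Set ℝ} (hC : IsLoopErasure p C)
    {s s' t' t : ℝ} (hs : s ∈ C) (ht : t ∈ C) (hss : s ≤ s') (hst : s' ≤ t') (htt : t' ≤ t)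
    (hd : Disjoint (Icc s' t') C) :
    ∃ a ∈ Icc s s', ∃ b ∈ Icc t' t, p a = p b := by
  have hc1 : IsCompact (C ∩ Icc s s') := isCompact_Icc.inter_left hC.isClosed
  have hc2 : IsCompact (C ∩ Icc t' t) := isCompact_Icc.inter_left hC.isClosed
  obtain ⟨a, ⟨haC, ha⟩, hamax⟩ := hc1.exists_isGreatest ⟨s, hs, le_rfl, hss⟩
  obtain ⟨b, ⟨hbC, hb⟩, hbmin⟩ := hc2.exists_isLeast ⟨t, ht, htt, le_rfl⟩
  refine ⟨a, ha, b, hb, ?_⟩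
  rcases (ha.2.trans (hst.trans hb.1)).eq_or_lt with h | h
  · rw [h]
  refine hC.gap a haC b hbC h (disjoint_left.2 fun r hr hrC => ?_)
  rcases le_or_gt r s' with h1 | h1
  · exact hr.1.not_ge (hamax ⟨hrC, ha.1.trans hr.1.le, h1⟩)
  rcases le_or_gt t' r with h2 | h2
  · exact hr.2.not_ge (hbmin ⟨hrC, h2, hr.2.le.trans hb.2⟩)
  · exact disjoint_left.1 hd ⟨h1.le, h2.le⟩ hrC

theorem IsLoopErasure.sInter {X : Type*} [MetricSpace X] {p : ℝ → X} (hp : Continuous p)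
    {c : Set (Set ℝ)} (hc : ∀ C ∈ c, IsLoopErasure p C) (hchain : IsChain (· ⊆ ·) c)
    (hne : c.Nonempty) : IsLoopErasure p (⋂₀ c) := by
  obtain ⟨C₀, hC₀⟩ := hne
  refine ⟨isClosed_sInter fun C hC => (hc C hC).isClosed,
    (sInter_subset_of_mem hC₀).trans (hc C₀ hC₀).subset, fun C hC => (hc C hC).zero_mem,
    fun C hC => (hc C hC).one_mem, fun s hs t ht hst hgap => ?_⟩
  refine eq_of_forall_dist_le fun ε hε => ?_
  obtain ⟨δ₁, hδ₁, h₁⟩ := Metric.continuous_iff.1 hp s (ε / 2) (half_pos hε)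
  obtain ⟨δ₂, hδ₂, h₂⟩ := Metric.continuous_iff.1 hp t (ε / 2) (half_pos hε)
  set η := min (min (δ₁ / 2) (δ₂ / 2)) ((t - s) / 3) with hη
  have hη0 : 0 < η := by
    refine lt_min (lt_min ?_ ?_) ?_ <;> linarith
  have hη1 : η ≤ δ₁ / 2 := (min_le_left _ _).trans (min_le_left _ _)
  have hη2 : η ≤ δ₂ / 2 := (min_le_left _ _).trans (min_le_right _ _)
  have hη3 : η ≤ (t - s) / 3 := min_le_right _ _
  have : Nonempty c := ⟨⟨C₀, hC₀⟩⟩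
  obtain ⟨⟨C, hC⟩, hCd⟩ := (isCompact_Icc (a := s + η) (b := t - η)).elim_directed_family_closed
    (fun C : c => (C : Set ℝ)) (fun C => (hc C C.2).isClosed)
    (by
      rw [← sInter_eq_iInter, ← disjoint_iff_inter_eq_empty]
      exact hgap.mono_left (Icc_subset_Ioo (by linarith) (by linarith)))
    (by
      rintro ⟨A, hA⟩ ⟨B, hB⟩
      rcases hchain.total hA hB with h | h
      · exact ⟨⟨A, hA⟩, subset_rfl, h⟩
      · exact ⟨⟨B, hB⟩, h, subset_rfl⟩)
  obtain ⟨a, ha, b, hb, hab⟩ := (hc C hC).exists_gap (hs C hC) (ht C hC)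
    (show s ≤ s + η by linarith) (show s + η ≤ t - η by linarith) (show t - η ≤ t by linarith)
    (disjoint_iff_inter_eq_empty.2 hCd)
  have e1 := h₁ a (by rw [Real.dist_eq, abs_lt]; constructor <;> linarith [ha.1, ha.2])
  have e2 := h₂ b (by rw [Real.dist_eq, abs_lt]; constructor <;> linarith [hb.1, hb.2])
  rw [hab] at e1
  linarith [dist_triangle_left (p s) (p t) (p b)]

theorem exists_minimal_isLoopErasure {X : Type*} [MetricSpace X] {p : ℝ → X}
    (hp : Continuous p) :
    ∃ C, IsLoopErasure p C ∧ ∀ s ∈ C, ∀ t ∈ C, s < t → p s = p t → Disjoint (Ioo s t) C := by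
  obtain ⟨C, -, hC, hmin⟩ := zorn_superset_nonempty {C | IsLoopErasure p C}
    (fun c hc hchain hne => ⟨⋂₀ c, .sInter hp hc hchain hne, fun _ => sInter_subset_of_mem⟩)
    (Icc 0 1) ⟨isClosed_Icc, subset_rfl, by simp, by simp, fun s hs t ht hst hd => by
      obtain ⟨r, hr⟩ := exists_between hst
      exact (disjoint_left.1 hd hr ⟨hs.1.trans hr.1.le, hr.2.le.trans ht.2⟩).elim⟩
  replace hC : IsLoopErasure p C := hC
  refine ⟨C, hC, fun s hs t ht hst hp => ?_⟩
  have hC' : IsLoopErasure p (C \ Ioo s t) := by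
    refine ⟨hC.isClosed.sdiff isOpen_Ioo, sdiff_subset.trans hC.subset,
      ⟨hC.zero_mem, fun h => h.1.not_ge (hC.subset hs).1⟩,
      ⟨hC.one_mem, fun h => h.2.not_ge (hC.subset ht).2⟩, ?_⟩
    rintro s' ⟨hs', hs'n⟩ t' ⟨ht', ht'n⟩ hst' hd
    by_cases hd' : Disjoint (Ioo s' t') C
    · exact hC.gap s' hs' t' ht' hst' hd'
    obtain ⟨r, hr, hrC⟩ := not_disjoint_iff.1 hd'
    have hrI : r ∈ Ioo s t := by
      by_contra h
      exact disjoint_left.1 hd hr ⟨hrC, h⟩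
    have h1 : ¬ s ∈ Ioo s' t' := fun h => disjoint_left.1 hd h ⟨hs, fun h => h.1.false⟩
    have h2 : ¬ t ∈ Ioo s' t' := fun h => disjoint_left.1 hd h ⟨ht, fun h => h.2.false⟩
    obtain rfl : s = s' := by
      refine le_antisymm (not_lt.1 fun h => h1 ⟨h, hrI.1.trans hr.2⟩)
        (not_lt.1 fun h => hs'n ⟨h, hr.1.trans hrI.2⟩)
    obtain rfl : t = t' := by
      refine le_antisymm (not_lt.1 fun h => ht'n ⟨hrI.1.trans hr.2, h⟩)
        (not_lt.1 fun h => h2 ⟨hr.1.trans hrI.2, h⟩)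
    exact hp
  exact disjoint_left.2 fun r hr hrC => (hmin hC' sdiff_subset hrC).2 hr

/-- Every path between distinct points contains an arc. -/
theorem exists_injective_path {X : Type*} [MetricSpace X] [CompactSpace X] {p : ℝ → X}
    (hp : Continuous p) (hne : p 0 ≠ p 1) :
    ∃ f : unitInterval → X, Continuous f ∧ Function.Injective f ∧ range f ⊆ p '' Icc 0 1 ∧
      f 0 = p 0 ∧ f 1 = p 1 := by
  obtain ⟨C, hC, hinj⟩ := exists_minimal_isLoopErasure hp
  have hex : ∀ t : unitInterval, ∃ r, IsGreatest (C ∩ Icc 0 (t : ℝ)) r := fun t =>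
    (isCompact_Icc.inter_left hC.isClosed).exists_isGreatest ⟨0, hC.zero_mem, le_rfl, t.2.1⟩
  choose m hm using hex
  have hmC : ∀ t, m t ∈ C := fun t => (hm t).1.1
  have hmle : ∀ t, m t ≤ t := fun t => (hm t).1.2.2
  have hmax : ∀ t : unitInterval, ∀ r ∈ C, r ≤ t → r ≤ m t := fun t r hr h =>
    (hm t).2 ⟨hr, (hC.subset hr).1, h⟩
  have hmm : Monotone m := fun s t hst => hmax t _ (hmC s) ((hmle s).trans hst)
  have hm0 : m 0 = 0 := le_antisymm (hmle 0) (hmax 0 0 hC.zero_mem le_rfl)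
  have hm1 : m 1 = 1 := le_antisymm (hmle 1) (hmax 1 1 hC.one_mem le_rfl)
  -- within `[s, t]` the erased path only takes values that `p` takes within `[s, t]`
  have hval : ∀ s t, s ≤ t → p (m s) = p (m t) ∨
      ∃ a ∈ Icc (s : ℝ) t, ∃ b ∈ Icc (s : ℝ) t, p a = p (m s) ∧ p b = p (m t) := by
    intro s t hst
    rcases le_or_gt (m t) s with h | h
    · left
      rw [le_antisymm (hmm hst) (hmax s _ (hmC t) h)]
    · right
      obtain ⟨b, ⟨hbC, hb⟩, hbmin⟩ :=
        (isCompact_Icc (a := (s : ℝ)) (b := t)).inter_left hC.isClosed |>.exists_isLeast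
          ⟨m t, hmC t, h.le, hmle t⟩
      refine ⟨b, hb, m t, ⟨h.le, hmle t⟩, ?_, rfl⟩
      rcases ((hmle s).trans hb.1).eq_or_lt with e | hlt
      · rw [e]
      refine (hC.gap _ (hmC s) _ hbC hlt (disjoint_left.2 fun r hr hrC => ?_)).symm
      rcases le_total r s with h' | h'
      · exact hr.1.not_ge (hmax s r hrC h')
      · exact hr.2.not_ge (hbmin ⟨hrC, h', hr.2.le.trans hb.2⟩)
  have hcont : Continuous fun t => p (m t) := by
    have hu : UniformContinuousOn p (Icc 0 1) :=
      isCompact_Icc.uniformContinuousOn_of_continuous hp.continuousOn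
    rw [Metric.uniformContinuousOn_iff] at hu
    rw [Metric.continuous_iff]
    intro t ε hε
    obtain ⟨δ, hδ, h⟩ := hu ε hε
    have key : ∀ s t : unitInterval, s ≤ t → dist s t < δ → dist (p (m s)) (p (m t)) < ε := by
      intro s t hst hd
      rcases hval s t hst with e | ⟨a, ha, b, hb, ea, eb⟩
      · rwa [e, dist_self]
      · rw [← ea, ← eb]
        refine h a ⟨s.2.1.trans ha.1, ha.2.trans t.2.2⟩ b ⟨s.2.1.trans hb.1, hb.2.trans t.2.2⟩ ?_
        rw [Subtype.dist_eq, Real.dist_eq, abs_sub_comm,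
          abs_of_nonneg (sub_nonneg.2 (Subtype.coe_le_coe.2 hst))] at hd
        rw [Real.dist_eq, abs_lt]
        constructor <;> linarith [ha.1, ha.2, hb.1, hb.2]
    refine ⟨δ, hδ, fun s hs => ?_⟩
    rcases le_total s t with hst | hst
    · exact key s t hst hs
    · rw [dist_comm]
      exact key t s hst (by rwa [dist_comm])
  obtain ⟨f, hf, hfi, hfr, hf0, hf1⟩ := exists_injective_reparametrization hcont
    (fun s r t hsr hrt e => by
      rcases (hmm hsr).eq_or_lt with h1 | h1
      · rw [h1]
      rcases (hmm hrt).eq_or_lt with h2 | h2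
      · exact (congrArg p h2).trans e.symm
      · exact (disjoint_left.1 (hinj _ (hmC s) _ (hmC t) (h1.trans h2) e) ⟨h1, h2⟩ (hmC r)).elim)
    (by simpa only [hm0, hm1] using hne)
  refine ⟨f, hf, hfi, ?_, by rw [hf0, hm0], by rw [hf1, hm1]⟩
  rw [hfr]
  rintro _ ⟨t, rfl⟩
  exact ⟨m t, hC.subset (hmC t), rfl⟩

/-- Two arcs which meet exactly in their endpoints form a simple closed curve. -/
theorem exists_homeomorph_circle_of_two_arcs {X : Type*} [TopologicalSpace X] [T2Space X]
    {f g : ℝ → X} (hf : Continuous f) (hg : Continuous g) {u v a b : ℝ} (huv : u < v)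
    (hab : a < b) (hfi : InjOn f (Icc u v)) (hgi : InjOn g (Icc a b)) (hua : f u = g a)
    (hvb : f v = g b)
    (hfg : ∀ s ∈ Icc u v, ∀ t ∈ Icc a b, f s = g t → (s = u ∧ t = a) ∨ (s = v ∧ t = b)) :
    ∃ C : Set X, Nonempty (C ≃ₜ Circle) := by
  let α : ℝ → ℝ := fun t => u + t * (v - u)
  let β : ℝ → ℝ := fun t => b - (t - 1) * (b - a)
  have hα : ∀ t, 0 ≤ t → t ≤ 1 → α t ∈ Icc u v := fun t h0 h1 => by
    constructor <;> simp only [α] <;> nlinarith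
  have hβ : ∀ t, 1 ≤ t → t ≤ 2 → β t ∈ Icc a b := fun t h0 h1 => by
    constructor <;> simp only [β] <;> nlinarith
  have hαi : Function.Injective α := fun s t h => by
    simpa [α, (sub_pos.2 huv).ne'] using h
  have hβi : Function.Injective β := fun s t h => by
    simpa [β, (sub_pos.2 hab).ne'] using h
  let F : ℝ → X := fun t => if t ≤ 1 then f (α t) else g (β t)
  have hF : Continuous F := by
    refine Continuous.if_le (by fun_prop) (by fun_prop) continuous_id continuous_const ?_
    rintro t rfl
    simpa [α, β] using hvb
  have hcross : ∀ s t, 0 ≤ s → s ≤ 1 → 1 < t → t < 2 → f (α s) ≠ g (β t) := by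
    intro s t h0 h1 h2 h3 h
    rcases hfg _ (hα s h0 h1) _ (hβ t h2.le h3.le) h with ⟨-, e⟩ | ⟨-, e⟩
    · have : β t = β 2 := by rw [e]; simp only [β]; ring
      exact h3.ne (hβi this)
    · have : β t = β 1 := by rw [e]; simp only [β]; ring
      exact h2.ne' (hβi this)
  have hFi : InjOn F (Ico 0 2) := by
    rintro s ⟨hs0, hs2⟩ t ⟨ht0, ht2⟩ h
    simp only [F] at h
    split_ifs at h with hs ht ht
    · exact hαi (hfi (hα s hs0 hs) (hα t ht0 ht) h)
    · exact (hcross s t hs0 hs (not_le.1 ht) ht2 h).elim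
    · exact (hcross t s ht0 ht (not_le.1 hs) hs2 h.symm).elim
    · exact hβi (hgi (hβ s (not_le.1 hs).le hs2.le) (hβ t (not_le.1 ht).le ht2.le) h)
  have : Fact ((0 : ℝ) < 2) := ⟨two_pos⟩
  let L : AddCircle (2 : ℝ) → X := AddCircle.liftIco 2 0 F
  have hL : Continuous L := by
    refine AddCircle.liftIco_continuous ?_ hF.continuousOn
    simp only [F, α, β]
    norm_num
    exact hua
  have hLi : Function.Injective L := by
    intro x y hxy
    obtain ⟨s, hs, rfl⟩ := AddCircle.eq_coe_Ico x
    obtain ⟨t, ht, rfl⟩ := AddCircle.eq_coe_Ico y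
    simp only [L] at hxy
    rw [AddCircle.liftIco_coe_apply (by simpa using hs),
      AddCircle.liftIco_coe_apply (by simpa using ht)] at hxy
    rw [hFi hs ht hxy]
  exact ⟨range L, ⟨(hL.isClosedEmbedding hLi).isEmbedding.toHomeomorph.symm.trans
    (AddCircle.homeomorphCircle two_ne_zero)⟩⟩

/-- Two arcs with the same endpoints, one of which misses a point of the other, contain a simple
closed curve. -/
theorem exists_homeomorph_circle_of_arc_avoiding {X : Type*} [TopologicalSpace X] [T2Space X]
    {f g : unitInterval → X} (hf : Continuous f) (hg : Continuous g) (hfi : Function.Injective f)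
    (hgi : Function.Injective g) (h0 : f 0 = g 0) (h1 : f 1 = g 1) {c : unitInterval}
    (hc : f c ∉ range g) : ∃ C : Set X, Nonempty (C ≃ₜ Circle) := by
  have hcl1 : IsClosed {t | g t ∈ f '' Iic c} :=
    (isClosed_Iic.isCompact.image hf).isClosed.preimage hg
  have hcl2 : IsClosed {t | g t ∈ f '' Ici c} :=
    (isClosed_Ici.isCompact.image hf).isClosed.preimage hg
  obtain ⟨a, ⟨u, huc, hu⟩, hamax⟩ :=
    hcl1.isCompact.exists_isGreatest ⟨0, 0, unitInterval.nonneg', h0⟩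
  obtain ⟨b, ⟨hab, v, hvc, hv⟩, hbmin⟩ := (isClosed_Ici.inter hcl2).isCompact.exists_isLeast
    ⟨1, unitInterval.le_one', 1, unitInterval.le_one', h1⟩
  have huc' : u < c := lt_of_le_of_ne huc fun h => hc ⟨a, by rw [← h, hu]⟩
  have hvc' : c < v := lt_of_le_of_ne hvc fun h => hc ⟨b, by rw [h, hv]⟩
  have hab' : a < b := lt_of_le_of_ne hab fun h =>
    (huc'.trans hvc').ne (hfi (by rw [hu, hv, h]))
  have key : ∀ s t, a ≤ t → t ≤ b → f s = g t → (s = u ∧ t = a) ∨ (s = v ∧ t = b) := by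
    intro s t hat htb h
    rcases le_total s c with hs | hs
    · obtain rfl := le_antisymm (hamax ⟨s, hs, h⟩) hat
      exact Or.inl ⟨hfi (h.trans hu.symm), rfl⟩
    · obtain rfl := le_antisymm htb (hbmin ⟨hat, s, hs, h⟩)
      exact Or.inr ⟨hfi (h.trans hv.symm), rfl⟩
  have hmem : ∀ {w z : unitInterval} {s : ℝ}, s ∈ Icc (w : ℝ) z → s ∈ Icc (0 : ℝ) 1 :=
    fun {w z s} hs => ⟨w.2.1.trans hs.1, hs.2.trans z.2.2⟩
  refine exists_homeomorph_circle_of_two_arcs (f := IccExtend zero_le_one f)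
    (g := IccExtend zero_le_one g) (u := u) (v := v) (a := a) (b := b)
    hf.Icc_extend' hg.Icc_extend' (huc'.trans hvc') hab' ?_ ?_ ?_ ?_ ?_
  · intro s hs t ht h
    rw [IccExtend_of_mem _ _ (hmem hs), IccExtend_of_mem _ _ (hmem ht)] at h
    exact congrArg Subtype.val (hfi h)
  · intro s hs t ht h
    rw [IccExtend_of_mem _ _ (hmem hs), IccExtend_of_mem _ _ (hmem ht)] at h
    exact congrArg Subtype.val (hgi h)
  · rw [IccExtend_val, IccExtend_val, hu]
  · rw [IccExtend_val, IccExtend_val, hv]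
  · intro s hs t ht h
    rw [IccExtend_of_mem _ _ (hmem hs), IccExtend_of_mem _ _ (hmem ht)] at h
    exact (key _ _ ht.1 ht.2 h).imp (fun e => ⟨congrArg Subtype.val e.1, congrArg Subtype.val e.2⟩)
      (fun e => ⟨congrArg Subtype.val e.1, congrArg Subtype.val e.2⟩)

/-- In a dendrite, an arc whose endpoints lie in one component of the complement of `x` does not
contain `x`. -/
theorem IsArcBetween.notMem_of_mem_connectedComponentIn {X : Type*} [MetricSpace X]
    [CompactSpace X] [LocallyConnectedSpace X] (hnc : ∀ C : Set X, ¬ Nonempty (C ≃ₜ Circle))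
    {x A B : X} {J : Set X} (hJ : IsArcBetween J A B) (hA : A ≠ x)
    (hB : B ∈ connectedComponentIn {x}ᶜ A) : x ∉ J := by
  obtain ⟨f, hf, hfi, rfl, hfA, hfB⟩ := hJ
  rintro ⟨c, rfl⟩
  have := locallyPathConnectedSpace_of_compact_of_locallyConnected (X := X)
  have hpc : IsPathConnected (connectedComponentIn {f c}ᶜ A) :=
    (isOpen_compl_singleton.connectedComponentIn.isConnected_iff_isPathConnected).1
      (isConnected_connectedComponentIn_iff.2 hA)
  obtain ⟨p, hp⟩ := hpc.joinedIn A (mem_connectedComponentIn hA) B hB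
  have hAB : A ≠ B := by
    rw [← hfA, ← hfB]
    exact fun h => zero_ne_one (congrArg Subtype.val (hfi h))
  obtain ⟨g, hg, hgi, hgr, hg0, hg1⟩ := exists_injective_path (p := p.extend)
    p.continuous_extend (by simpa using hAB)
  obtain ⟨C, hC⟩ := exists_homeomorph_circle_of_arc_avoiding hf hg hfi hgi
    (hfA.trans (by simpa using hg0.symm)) (hfB.trans (by simpa using hg1.symm)) (c := c) (by
      intro hc
      obtain ⟨t, ht, h⟩ := hgr hc
      rw [p.extend_apply ht] at h
      exact connectedComponentIn_subset _ _ (hp ⟨t, ht⟩) h)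
  exact hnc C hC

theorem IsArcBetween.left_mem {X : Type*} [TopologicalSpace X] {J : Set X} {A B : X}
    (h : IsArcBetween J A B) : A ∈ J := by
  obtain ⟨f, -, -, rfl, rfl, -⟩ := h
  exact mem_range_self _

theorem IsArcBetween.right_mem {X : Type*} [TopologicalSpace X] {J : Set X} {A B : X}
    (h : IsArcBetween J A B) : B ∈ J := by
  obtain ⟨f, -, -, rfl, -, rfl⟩ := h
  exact mem_range_self _

theorem IsArcBetween.isPreconnected {X : Type*} [TopologicalSpace X] {J : Set X} {A B : X}
    (h : IsArcBetween J A B) : IsPreconnected J := by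
  obtain ⟨f, hf, -, rfl, -, -⟩ := h
  exact isPreconnected_range hf

theorem IsArcBetween.isPreconnected_diff_left {X : Type*} [TopologicalSpace X] {J : Set X}
    {A B : X} (h : IsArcBetween J A B) : IsPreconnected (J \ {A}) := by
  obtain ⟨f, hf, hfi, rfl, rfl, -⟩ := h
  have : range f \ {f ⟨0, by norm_num⟩} = f '' Ioi (⟨0, by norm_num⟩ : Icc (0 : ℝ) 1) := by
    rw [← image_univ, ← image_singleton, ← image_sdiff hfi]
    congr 1
    ext t
    rw [Set.mem_sdiff, mem_singleton_iff, mem_Ioi, lt_iff_le_and_ne]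
    exact ⟨fun ht => ⟨t.2.1, Ne.symm ht.2⟩, fun ht => ⟨trivial, Ne.symm ht.2⟩⟩
  rw [this]
  exact ordConnected_Ioi.isPreconnected.image f hf.continuousOn

theorem IsArcBetween.isPreconnected_diff_right {X : Type*} [TopologicalSpace X] {J : Set X}
    {A B : X} (h : IsArcBetween J A B) : IsPreconnected (J \ {B}) := by
  obtain ⟨f, hf, hfi, rfl, -, rfl⟩ := h
  have : range f \ {f ⟨1, by norm_num⟩} = f '' Iio (⟨1, by norm_num⟩ : Icc (0 : ℝ) 1) := by
    rw [← image_univ, ← image_singleton, ← image_sdiff hfi]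
    congr 1
    ext t
    rw [Set.mem_sdiff, mem_singleton_iff, mem_Iio, lt_iff_le_and_ne]
    exact ⟨fun ht => ⟨t.2.2, ht.2⟩, fun ht => ⟨trivial, ht.2⟩⟩
  rw [this]
  exact ordConnected_Iio.isPreconnected.image f hf.continuousOn

/-- In a dendrite `K` (the whole space `X`) with finite `V ⊆ X` and main tree
`γ̂ = ⋃_{A ≠ B ∈ V} γ(A,B)`: a point `x` is a cut point of `γ̂` iff there exist
`A, B ∈ V` lying in different connected components of `K \ {x}`. -/
theorem stmt_16 {X : Type*} [MetricSpace X] [CompactSpace X] [ConnectedSpace X]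
    [LocallyConnectedSpace X]
    (hnc : ∀ C : Set X, ¬ Nonempty (C ≃ₜ Circle))
    (V : Finset X) (γ : X → X → Set X)
    (hγ : ∀ a b : X, a ≠ b → IsArcBetween (γ a b) a b)
    (hγself : ∀ a : X, γ a a = {a})
    (x : X) :
    (x ∈ (⋃ A ∈ (V : Set X), ⋃ B ∈ (V : Set X), ⋃ (_ : A ≠ B), γ A B) ∧
      ¬ IsPreconnected
        ((⋃ A ∈ (V : Set X), ⋃ B ∈ (V : Set X), ⋃ (_ : A ≠ B), γ A B) \ {x})) ↔
    ∃ A ∈ V, ∃ B ∈ V, A ≠ x ∧ B ≠ x ∧ B ∉ connectedComponentIn {x}ᶜ A := by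
  set T := ⋃ A ∈ (V : Set X), ⋃ B ∈ (V : Set X), ⋃ (_ : A ≠ B), γ A B with hT
  have hsub : ∀ A ∈ V, ∀ B ∈ V, A ≠ B → γ A B ⊆ T := by
    intro A hA B hB hAB y hy
    simp only [hT, mem_iUnion]
    exact ⟨A, hA, B, hB, hAB, hy⟩
  constructor
  · rintro ⟨-, hnot⟩
    by_contra! hsame
    have havoid : ∀ A ∈ V, ∀ B ∈ V, A ≠ B → A ≠ x → B ≠ x → x ∉ γ A B :=
      fun A hA B hB hAB hAx hBx =>
        (hγ A B hAB).notMem_of_mem_connectedComponentIn hnc hAx (hsame A hA B hB hAx hBx)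
    -- every point of `T \ {x}` is joined within `T \ {x}` to a vertex other than `x`
    have hjoin : ∀ y ∈ T \ {x}, ∃ A ∈ V, A ≠ x ∧
        ∃ S ⊆ T \ {x}, y ∈ S ∧ A ∈ S ∧ IsPreconnected S := by
      rintro y ⟨hy, hyx⟩
      simp only [hT, mem_iUnion] at hy
      obtain ⟨A, hA, B, hB, hAB, hy⟩ := hy
      have harc := hγ A B hAB
      have hS : γ A B \ {x} ⊆ T \ {x} := sdiff_subset_sdiff_left (hsub A hA B hB hAB)
      by_cases hAx : A = x
      · subst hAx
        exact ⟨B, hB, hAB.symm, _, hS, ⟨hy, hyx⟩, ⟨harc.right_mem, hAB.symm⟩,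
          harc.isPreconnected_diff_left⟩
      refine ⟨A, hA, hAx, _, hS, ⟨hy, hyx⟩, ⟨harc.left_mem, hAx⟩, ?_⟩
      by_cases hBx : B = x
      · subst hBx
        exact harc.isPreconnected_diff_right
      · rw [sdiff_singleton_eq_self (havoid A hA B hB hAB hAx hBx)]
        exact harc.isPreconnected
    refine hnot (isPreconnected_of_forall_pair fun y hy z hz => ?_)
    obtain ⟨A, hA, hAx, S, hS, hyS, hAS, hSc⟩ := hjoin y hy
    obtain ⟨B, hB, hBx, R, hR, hzR, hBR, hRc⟩ := hjoin z hz
    by_cases hAB : A = B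
    · subst hAB
      exact ⟨S ∪ R, union_subset hS hR, Or.inl hyS, Or.inr hzR, hSc.union A hAS hBR hRc⟩
    · have harc := hγ A B hAB
      exact ⟨(S ∪ γ A B) ∪ R, union_subset (union_subset hS (subset_sdiff_singleton
        (hsub A hA B hB hAB) (havoid A hA B hB hAB hAx hBx))) hR, Or.inl (Or.inl hyS),
        Or.inr hzR, (hSc.union A hAS harc.left_mem harc.isPreconnected).union B
          (Or.inr harc.right_mem) hBR hRc⟩
  · rintro ⟨A, hA, B, hB, hAx, hBx, hsep⟩
    have hAB : A ≠ B := by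
      rintro rfl
      exact hsep (mem_connectedComponentIn hAx)
    have harc := hγ A B hAB
    have hTAB := hsub A hA B hB hAB
    refine ⟨hTAB ?_, fun hpre => hsep ?_⟩
    · by_contra hx
      exact hsep (harc.isPreconnected.subset_connectedComponentIn harc.left_mem
        (subset_compl_singleton_iff.2 hx) harc.right_mem)
    · exact hpre.subset_connectedComponentIn ⟨hTAB harc.left_mem, hAx⟩ (fun y hy => hy.2)
        ⟨hTAB harc.right_mem, hBx⟩
end
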